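/- Let ψ ∈ F, β ∈ ℝ, and let p = p(n) be a sequence of natural numbers with p(n) ≤ n such that T(n) ≍ p(n) (i.e. there exist constants 0 < c₁ ≤ c₂ with c₁ p(n) ≤ T(n) ≤ c₂ p(n) for all n), where T(n) = η(ψ;n) − n. Then E(C^ψ_{β,∞}; U^ψ_{n,p(n)}) ≍ E_n(C^ψ_{β,∞}) ≍ ψ(n), i.e. there exist constants K₁, K₂ > 0 such that K₁ ψ(n) ≤ E(C^ψ_{β,∞}; U^ψ_{n,p(n)}) ≤ K₂ ψ(n) and K₁ ψ(n) ≤ E_n(C^ψ_{β,∞}) ≤ K₂ ψ(n) for all n; thus the sums U^ψ_{n,p} realize the order of best uniform approximation of the class C^ψ_{β,∞}. -/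

import Mathlib

open MeasureTheory Real Filter Set

noncomputable section

/-- The `k`-th Fourier cosine coefficient of a `2π`-periodic function. -/
def fourierA (f : ℝ → ℝ) (k : ℕ) : ℝ := (1 / π) * ∫ t in (-π)..π, f t * Real.cos (k * t)

/-- The `k`-th Fourier sine coefficient of a `2π`-periodic function. -/
def fourierB (f : ℝ → ℝ) (k : ℕ) : ℝ := (1 / π) * ∫ t in (-π)..π, f t * Real.sin (k * t)

/-- The harmonicTerm `A_k(f;x)`. -/
def harmonicTerm (f : ℝ → ℝ) (k : ℕ) (x : ℝ) : ℝ :=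
  if k = 0 then fourierA f 0 / 2
  else fourierA f k * Real.cos (k * x) + fourierB f k * Real.sin (k * x)

/-- `2π`-periodicity. -/
def Periodic2pi (f : ℝ → ℝ) : Prop := ∀ x, f (x + 2 * π) = f x

/-- The set `S_∞`: measurable `2π`-periodic functions essentially bounded by 1. -/
def SInf (φ : ℝ → ℝ) : Prop :=
  Measurable φ ∧ Periodic2pi φ ∧ (∀ᵐ t ∂(volume : Measure ℝ), |φ t| ≤ 1)

/-- `φ` is the `(ψ,β)`-derivative of `f`: `φ ∈ S_∞` and the series
`Σ (1/ψ k)(a_k(f) cos(kx+βπ/2) + b_k(f) sin(kx+βπ/2))` is the Fourier series of `φ`. -/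
def IsPsiDeriv (ψ : ℕ → ℝ) (β : ℝ) (f φ : ℝ → ℝ) : Prop :=
  SInf φ ∧ fourierA φ 0 = 0 ∧
    ∀ k : ℕ, 1 ≤ k →
      fourierA φ k = (1 / ψ k) *
        (fourierA f k * Real.cos (β * π / 2) + fourierB f k * Real.sin (β * π / 2)) ∧
      fourierB φ k = (1 / ψ k) *
        (fourierB f k * Real.cos (β * π / 2) - fourierA f k * Real.sin (β * π / 2))

/-- The class `C^ψ_{β,∞}`. -/
def ClassC (ψ : ℕ → ℝ) (β : ℝ) (f : ℝ → ℝ) : Prop :=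
  Continuous f ∧ Periodic2pi f ∧ ∃ φ, IsPsiDeriv ψ β f φ

/-- Multipliers of the sums `U^ψ_{n,p}` (with `φ(k) = (k-n+p)/ψ(k)`). -/
def lambdaU (ψ : ℕ → ℝ) (n p k : ℕ) : ℝ :=
  if k ≤ n - p then 1
  else 1 - (((k : ℝ) - n + p) / ψ k) / ((p : ℝ) / ψ n)

/-- The sums `U^ψ_{n,p}(f;x)`. -/
def Usum (ψ : ℕ → ℝ) (n p : ℕ) (f : ℝ → ℝ) (x : ℝ) : ℝ :=
  ∑ k ∈ Finset.range n, lambdaU ψ n p k * harmonicTerm f k x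

/-- `E(C^ψ_{β,∞}; T) = sup_{f ∈ C^ψ_{β,∞}} ‖f - T f‖_C`. -/
def classSup (ψ : ℕ → ℝ) (β : ℝ) (T : (ℝ → ℝ) → ℝ → ℝ) : ℝ :=
  sSup {e | ∃ f, ClassC ψ β f ∧ e = ⨆ x : ℝ, |f x - T f x|}

/-- The characteristic `η(ψ;t) = ψ⁻¹(ψ(t)/2)` (inverse taken on `[1,∞)`). -/
def eta (ψ : ℝ → ℝ) (t : ℝ) : ℝ := Function.invFunOn ψ (Set.Ici 1) (ψ t / 2)

/-- The set `M`: positive convex functions on `[1,∞)` vanishing at infinity. -/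
def MClass (ψ : ℝ → ℝ) : Prop :=
  (∀ t ≥ (1 : ℝ), 0 < ψ t) ∧ ConvexOn ℝ (Set.Ici 1) ψ ∧ Tendsto ψ atTop (nhds 0)

/-- The set `F = {ψ ∈ M : η'(ψ;t) ≤ K for all t ≥ 1}`. -/
def FClass (ψ : ℝ → ℝ) : Prop :=
  MClass ψ ∧ ∃ K : ℝ, ∀ t ≥ (1 : ℝ), DifferentiableAt ℝ (eta ψ) t ∧ deriv (eta ψ) t ≤ K

/-- `g` is a trigonometric polynomial of degree at most `m`. -/
def IsTrigPoly (m : ℕ) (g : ℝ → ℝ) : Prop :=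
  ∃ c d : ℕ → ℝ, ∀ x, g x =
    ∑ k ∈ Finset.range (m + 1), (c k * Real.cos (k * x) + d k * Real.sin (k * x))

/-- `E_n(C^ψ_{β,∞})`: best uniform approximation of the class by trigonometric
polynomials of degree at most `n-1`. -/
def bestApproxClass (ψ : ℕ → ℝ) (β : ℝ) (n : ℕ) : ℝ :=
  sSup {e | ∃ f, ClassC ψ β f ∧
    e = sInf {r | ∃ g, IsTrigPoly (n - 1) g ∧ r = ⨆ x : ℝ, |f x - g x|}}

theorem MClass.strictAntiOn {ψ : ℝ → ℝ} (h : MClass ψ) : StrictAntiOn ψ (Ici 1) := by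
  intro x hx y hy hxy
  by_contra! hle
  have hev : ∀ᶠ z in atTop, ψ z < ψ y := h.2.2.eventually (gt_mem_nhds (h.1 y hy))
  obtain ⟨z, hz, hyz⟩ := (hev.and (eventually_gt_atTop y)).exists
  have hs := h.2.1.slope_mono_adjacent hx (mem_Ici.2 ((mem_Ici.1 hy).trans hyz.le)) hxy hyz
  have h1 : 0 ≤ (ψ y - ψ x) / (y - x) := div_nonneg (by linarith) (by linarith)
  have h2 : (ψ z - ψ y) / (z - y) < 0 := div_neg_of_neg_of_pos (by linarith) (by linarith)
  linarith

theorem MClass.eta_spec {ψ : ℝ → ℝ} (h : MClass ψ) {t : ℝ} (ht : 1 < t) :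
    t < eta ψ t ∧ ψ (eta ψ t) = ψ t / 2 := by
  have hpos := h.1 t ht.le
  have hev : ∀ᶠ z in atTop, ψ z < ψ t / 2 := h.2.2.eventually (gt_mem_nhds (by linarith))
  obtain ⟨b, hb, htb⟩ := (hev.and (eventually_gt_atTop t)).exists
  have hcont : ContinuousOn ψ (Icc t b) := by
    refine h.2.1.continuousOn_interior.mono ?_
    rw [interior_Ici]
    exact fun x hx => ht.trans_le hx.1
  obtain ⟨s, hs, hst⟩ := intermediate_value_Icc' htb.le hcont
    (show ψ t / 2 ∈ Icc (ψ b) (ψ t) from ⟨hb.le, by linarith⟩)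
  have hex : ∃ a ∈ Ici (1 : ℝ), ψ a = ψ t / 2 := ⟨s, ht.le.trans hs.1, hst⟩
  have hmem : eta ψ t ∈ Ici (1 : ℝ) := Function.invFunOn_mem hex
  have heq : ψ (eta ψ t) = ψ t / 2 := Function.invFunOn_eq hex
  refine ⟨?_, heq⟩
  by_contra! hle
  have := h.strictAntiOn.antitoneOn hmem (mem_Ici.2 ht.le) hle
  linarith

theorem eta_sub_le {ψ : ℝ → ℝ} {K : ℝ}
    (hK : ∀ t ≥ (1 : ℝ), DifferentiableAt ℝ (eta ψ) t ∧ deriv (eta ψ) t ≤ K)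
    {a b : ℝ} (ha : 1 ≤ a) (hab : a ≤ b) : eta ψ b - eta ψ a ≤ K * (b - a) := by
  have hge : ∀ x ∈ Icc a b, (1 : ℝ) ≤ x := fun x hx => ha.trans hx.1
  refine (convex_Icc a b).image_sub_le_mul_sub_of_deriv_le
    (fun x hx => (hK x (hge x hx)).1.continuousAt.continuousWithinAt)
    (fun x hx => (hK x (hge x (interior_subset hx))).1.differentiableWithinAt)
    (fun x hx => (hK x (hge x (interior_subset hx))).2) a (left_mem_Icc.2 hab) b
    (right_mem_Icc.2 hab) hab

/-- The initial drop of `ψ` is controlled by its halving length. -/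
theorem MClass.sub_succ_mul_le {ψ : ℝ → ℝ} (h : MClass ψ) {K : ℝ}
    (hK : ∀ t ≥ (1 : ℝ), DifferentiableAt ℝ (eta ψ) t ∧ deriv (eta ψ) t ≤ K)
    {t : ℝ} (ht : 1 < t) : (ψ t - ψ (t + 1)) * (eta ψ t - t) ≤ K * ψ t := by
  obtain ⟨h1, h2⟩ := h.eta_spec ht
  obtain ⟨h3, h4⟩ := h.eta_spec (show 1 < t + 1 by linarith)
  have hlip := eta_sub_le hK ht.le (show t ≤ t + 1 by linarith)
  have hanti := h.strictAntiOn (mem_Ici.2 ht.le) (mem_Ici.2 (by linarith : (1 : ℝ) ≤ t + 1))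
    (by linarith)
  have hlt : eta ψ t < eta ψ (t + 1) := by
    by_contra! hle
    have := h.strictAntiOn.antitoneOn (mem_Ici.2 (by linarith : (1 : ℝ) ≤ eta ψ (t + 1)))
      (mem_Ici.2 (by linarith : (1 : ℝ) ≤ eta ψ t)) hle
    linarith
  have hs := h.2.1.slope_mono_adjacent (mem_Ici.2 ht.le)
    (mem_Ici.2 (by linarith : (1 : ℝ) ≤ eta ψ (t + 1))) h1 hlt
  rw [h2, h4, div_le_div_iff₀ (by linarith) (by linarith)] at hs
  have hpos := h.1 t ht.le
  nlinarith

theorem MClass.halving_iterate {ψ : ℝ → ℝ} (h : MClass ψ) {K L : ℝ}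
    (hK : ∀ t ≥ (1 : ℝ), DifferentiableAt ℝ (eta ψ) t ∧ deriv (eta ψ) t ≤ K)
    (hL : K + 1 ≤ L) (hL1 : 1 ≤ L) {t : ℝ} (ht : 1 < t) (m : ℕ) :
    ∃ x, t ≤ x ∧ x - t ≤ L ^ m * (eta ψ t - t) ∧ ψ x = ψ t / 2 ^ (m + 1) := by
  have h0 := h.eta_spec ht
  induction m with
  | zero => exact ⟨eta ψ t, h0.1.le, by simp, by simpa using h0.2⟩
  | succ m ih =>
    obtain ⟨x, hx, hxt, hψ⟩ := ih
    have hx' := h.eta_spec (ht.trans_le hx)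
    refine ⟨eta ψ x, hx.trans hx'.1.le, ?_, by rw [hx'.2, hψ, pow_succ 2 (m + 1)]; field_simp⟩
    have hlip := eta_sub_le hK ht.le hx
    have hpow : 1 ≤ L ^ m := one_le_pow₀ hL1
    have hT : 0 < eta ψ t - t := by linarith [h0.1]
    have e1 : K * (x - t) ≤ (L - 1) * (x - t) := by
      apply mul_le_mul_of_nonneg_right <;> linarith
    have e2 : (L - 1) * (x - t) ≤ (L - 1) * (L ^ m * (eta ψ t - t)) :=
      mul_le_mul_of_nonneg_left hxt (by linarith)
    have e3 : eta ψ t - t ≤ L ^ m * (eta ψ t - t) := le_mul_of_one_le_left hT.le hpow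
    rw [pow_succ]
    linarith

theorem FClass.geometric_decay {ψ : ℝ → ℝ} (hψ : FClass ψ) {p : ℕ → ℕ}
    (hp : ∀ n : ℕ, 1 ≤ n → 1 ≤ p n ∧ p n ≤ n) {c : ℝ}
    (hT : ∀ n : ℕ, 1 ≤ n → eta ψ n - n ≤ c * p n) :
    ∃ L : ℕ, 2 ≤ L ∧ ∀ n : ℕ, 1 ≤ n → ∀ m : ℕ,
      ψ ((n + p n * L ^ m : ℕ) : ℝ) ≤ 2 * ψ n / 2 ^ m := by
  obtain ⟨h, K, hK⟩ := hψ
  obtain ⟨L, hL⟩ := exists_nat_ge (max (K + 1) (max c 4))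
  have hLK : K + 1 ≤ L := (le_max_left _ _).trans hL
  have hLc : c ≤ L := (le_max_left _ _).trans ((le_max_right _ _).trans hL)
  have hL4 : (4 : ℝ) ≤ L := (le_max_right _ _).trans ((le_max_right _ _).trans hL)
  have hL4' : 4 ≤ L := by exact_mod_cast hL4
  have anti : ∀ a b : ℕ, 1 ≤ a → a ≤ b → ψ b ≤ ψ a := fun a b ha hab =>
    h.strictAntiOn.antitoneOn (mem_Ici.2 (by exact_mod_cast ha))
      (mem_Ici.2 (by exact_mod_cast ha.trans hab)) (by exact_mod_cast hab)
  have main : ∀ n : ℕ, 2 ≤ n → ∀ m : ℕ, ψ ((n + p n * L ^ m : ℕ) : ℝ) ≤ ψ n / 2 ^ m := by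
    intro n hn m
    cases m with
    | zero => simpa only [pow_zero, div_one, mul_one] using anti n (n + p n) (by omega) (by omega)
    | succ m =>
      have hn1 : (1 : ℝ) < n := by exact_mod_cast hn
      obtain ⟨x, hx, hxt, hψx⟩ := h.halving_iterate hK hLK (by linarith) hn1 m
      rw [← hψx]
      refine h.strictAntiOn.antitoneOn (mem_Ici.2 (hn1.le.trans hx)) ?_ ?_
      · exact mem_Ici.2 (by exact_mod_cast (by omega : 1 ≤ n + p n * L ^ (m + 1)))
      · push_cast
        have e1 : eta ψ n - n ≤ L * p n := (hT n (by omega)).trans (by gcongr)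
        have e2 : (L : ℝ) ^ m * (eta ψ n - n) ≤ L ^ m * (L * p n) := by gcongr
        rw [pow_succ]
        linarith
  refine ⟨L, by omega, fun n hn m => ?_⟩
  rcases hn.eq_or_lt with rfl | hn2
  · have hp1 : p 1 = 1 := by have := hp 1 le_rfl; omega
    rw [hp1]
    cases m with
    | zero =>
      have := anti 1 (1 + 1 * L ^ 0) (by omega) (by omega)
      have := h.1 1 le_rfl
      simp at *
      linarith
    | succ m =>
      have hle : 2 + p 2 * L ^ m ≤ 1 + 1 * L ^ (m + 1) := by
        have h1 : 1 ≤ L ^ m := Nat.one_le_pow _ _ (by omega)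
        have h2 := (hp 2 (by omega)).2
        rw [pow_succ]
        nlinarith
      have e1 := anti _ _ (by omega) hle
      have e2 := main 2 le_rfl m
      have e3 := anti 1 2 le_rfl (by omega)
      refine e1.trans (e2.trans ?_)
      rw [pow_succ, mul_comm (2 ^ m) (2 : ℝ), mul_div_mul_left _ _ two_ne_zero]
      gcongr
  · refine (main n hn2 m).trans ?_
    have := h.1 n (by exact_mod_cast hn)
    gcongr
    linarith

theorem sum_div_add_le {u : ℕ → ℝ} (hu0 : ∀ j, 0 ≤ u j) (hu : Antitone u) {p L : ℕ} (hp : 1 ≤ p)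
    (hL : 2 ≤ L) (hdec : ∀ m, u (p * L ^ m) ≤ 2 * u 0 / 2 ^ m) (N : ℕ) :
    ∑ j ∈ Finset.range N, u j / (p + j) ≤ (1 + 4 * L) * u 0 := by
  have hp0 : (0 : ℝ) < p := by exact_mod_cast hp
  have hL0 : (0 : ℝ) < L := by exact_mod_cast (by omega : 0 < L)
  have key : ∀ m : ℕ, ∑ j ∈ Finset.range (p * L ^ m), u j / (p + j) ≤
      u 0 + 4 * L * u 0 * (1 - 1 / 2 ^ m) := by
    intro m
    induction m with
    | zero =>
      calc ∑ j ∈ Finset.range (p * L ^ 0), u j / (p + j)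
          ≤ ∑ j ∈ Finset.range (p * L ^ 0), u 0 / p := by
            refine Finset.sum_le_sum fun j _ => ?_
            have := hu0 0
            have := hu (Nat.zero_le j)
            gcongr
            simp
        _ = _ := by simp; field_simp
    | succ m ih =>
      have hle : p * L ^ m ≤ p * L ^ (m + 1) :=
        Nat.mul_le_mul_left _ (Nat.pow_le_pow_right (by omega) (by omega))
      rw [← Finset.sum_range_add_sum_Ico _ hle]
      have hI : ∑ j ∈ Finset.Ico (p * L ^ m) (p * L ^ (m + 1)), u j / (p + j) ≤
          ∑ j ∈ Finset.Ico (p * L ^ m) (p * L ^ (m + 1)), (2 * u 0 / 2 ^ m) / (p * L ^ m) := by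
        refine Finset.sum_le_sum fun j hj => ?_
        have hj' := (Finset.mem_Ico.1 hj).1
        have h1 : u j ≤ 2 * u 0 / 2 ^ m := (hu hj').trans (hdec m)
        have h2 : (p * L ^ m : ℝ) ≤ j := by exact_mod_cast hj'
        have := hu0 j
        gcongr
        · linarith
        · linarith
      have hcard : ∑ j ∈ Finset.Ico (p * L ^ m) (p * L ^ (m + 1)),
          (2 * u 0 / 2 ^ m) / (p * L ^ m : ℝ) ≤ 2 * L * u 0 / 2 ^ m := by
        rw [Finset.sum_const, Nat.card_Ico, nsmul_eq_mul, Nat.cast_sub hle]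
        push_cast
        have h0 := hu0 0
        calc ((p : ℝ) * L ^ (m + 1) - p * L ^ m) * ((2 * u 0 / 2 ^ m) / (p * L ^ m))
            ≤ (p * L ^ (m + 1)) * ((2 * u 0 / 2 ^ m) / (p * L ^ m)) := by
              apply mul_le_mul_of_nonneg_right _ (by positivity)
              have : (0 : ℝ) ≤ p * L ^ m := by positivity
              linarith
          _ = _ := by field_simp; ring
      have : 2 * L * u 0 / 2 ^ m = 4 * L * u 0 * (1 - 1 / 2 ^ (m + 1)) -
          4 * L * u 0 * (1 - 1 / 2 ^ m) := by
        field_simp; ring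
      linarith
  have hN : N ≤ p * L ^ N :=
    (Nat.lt_pow_self (by omega)).le.trans (Nat.le_mul_of_pos_left _ (by omega))
  calc ∑ j ∈ Finset.range N, u j / (p + j)
      ≤ ∑ j ∈ Finset.range (p * L ^ N), u j / (p + j) :=
        Finset.sum_le_sum_of_subset_of_nonneg (Finset.range_mono hN)
          fun j _ _ => div_nonneg (hu0 j) (by positivity)
    _ ≤ _ := key N
    _ ≤ _ := by
      have : (0 : ℝ) ≤ 4 * L * u 0 * (1 / 2 ^ N) := by have := hu0 0; positivity
      linarith

theorem one_sub_sq_mul_sum (a : ℕ → ℝ) (z : ℂ) (R : ℕ) :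
    (1 - z) ^ 2 * ∑ k ∈ Finset.range R, (a k : ℂ) * z ^ k =
      a 0 * (1 - 2 * z) + a 1 * z +
        ∑ k ∈ Finset.range R, ((a (k + 2) - 2 * a (k + 1) + a k : ℝ) : ℂ) * z ^ (k + 2) -
        a R * (z ^ R - 2 * z ^ (R + 1)) - a (R + 1) * z ^ (R + 1) := by
  induction R with
  | zero => simp
  | succ R ih =>
    rw [Finset.sum_range_succ, Finset.sum_range_succ, mul_add, ih]
    push_cast
    ring

theorem one_sub_mul_sum (a : ℕ → ℝ) (z : ℂ) (R : ℕ) :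
    (1 - z) * ∑ k ∈ Finset.range R, (a k : ℂ) * z ^ k =
      a 0 - ∑ k ∈ Finset.range R, ((a k - a (k + 1) : ℝ) : ℂ) * z ^ (k + 1) - a R * z ^ R := by
  induction R with
  | zero => simp
  | succ R ih =>
    rw [Finset.sum_range_succ, Finset.sum_range_succ, mul_add, ih]
    push_cast
    ring

theorem norm_sum_mul_le {z : ℂ} (hz : ‖z‖ = 1) (e : ℕ → ℕ) (a : ℕ → ℝ) (R : ℕ) :
    ‖∑ k ∈ Finset.range R, (a k : ℂ) * z ^ e k‖ ≤ ∑ k ∈ Finset.range R, |a k| := by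
  refine (norm_sum_le _ _).trans (Finset.sum_le_sum fun k _ => ?_)
  simp [hz]

theorem norm_one_sub_mul_sum_le {d : ℕ → ℝ} (hd : Antitone d) (hd0 : ∀ j, 0 ≤ d j) {z : ℂ}
    (hz : ‖z‖ = 1) (R : ℕ) :
    ‖1 - z‖ * ‖∑ k ∈ Finset.range R, (d k : ℂ) * z ^ k‖ ≤ 2 * d 0 := by
  rw [← norm_mul, one_sub_mul_sum]
  have h1 := norm_sum_mul_le hz (fun k => k + 1) (fun k => d k - d (k + 1)) R
  have h2 : ∑ k ∈ Finset.range R, |d k - d (k + 1)| = d 0 - d R := by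
    rw [← Finset.sum_range_sub']
    exact Finset.sum_congr rfl fun k _ => abs_of_nonneg (sub_nonneg.2 (hd k.le_succ))
  have h3 : ‖(d 0 : ℂ)‖ = d 0 := by simp [abs_of_nonneg (hd0 0)]
  have h4 : ‖(d R : ℂ) * z ^ R‖ = d R := by simp [hz, abs_of_nonneg (hd0 R)]
  have h5 := norm_sub_le ((d 0 : ℂ) -
    ∑ k ∈ Finset.range R, ((d k - d (k + 1) : ℝ) : ℂ) * z ^ (k + 1)) (d R * z ^ R)
  have h6 := norm_sub_le (d 0 : ℂ)
    (∑ k ∈ Finset.range R, ((d k - d (k + 1) : ℝ) : ℂ) * z ^ (k + 1))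
  linarith

theorem two_div_pi_mul_le_norm_one_sub_exp {t : ℝ} (ht0 : 0 ≤ t) (ht : t ≤ π) :
    2 / π * t ≤ ‖1 - Complex.exp (t * Complex.I)‖ := by
  rw [norm_sub_rev, mul_comm (t : ℂ), Complex.norm_exp_I_mul_ofReal_sub_one, norm_mul, norm_two,
    Real.norm_eq_abs]
  have h := Real.mul_le_sin (x := t / 2) (by linarith) (by linarith)
  have := le_abs_self (Real.sin (t / 2))
  have e : 2 / π * t = 2 * (2 / π * (t / 2)) := by ring
  rw [e]
  linarith

/-- The sequence `a` rises linearly from `0` to `A` over `p` steps and then continues as the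
nonnegative convex decreasing sequence `d`, which vanishes from `M` on. -/
structure LinearThenConvex (A : ℝ) (p M : ℕ) (a d : ℕ → ℝ) : Prop where
  one_le : 1 ≤ p
  linear : ∀ i ≤ p, a i = A * i / p
  tail : ∀ j, a (p + j) = d j
  nonneg : ∀ j, 0 ≤ d j
  anti : Antitone d
  convex : ∀ j, 0 ≤ d (j + 2) - 2 * d (j + 1) + d j
  vanish : ∀ j, M ≤ j → d j = 0

namespace LinearThenConvex

variable {A : ℝ} {p M : ℕ} {a d : ℕ → ℝ}

theorem d_zero (h : LinearThenConvex A p M a d) : d 0 = A := by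
  have h0 : (p : ℝ) ≠ 0 := by have := h.one_le; positivity
  have h1 := h.tail 0
  rw [add_zero, h.linear p le_rfl, mul_div_assoc, div_self h0, mul_one] at h1
  exact h1.symm

theorem sum_abs_second_difference_le (h : LinearThenConvex A p M a d) :
    ∑ k ∈ Finset.range (p + M), |a (k + 2) - 2 * a (k + 1) + a k| ≤
      A / p + 2 * (d 0 - d 1) := by
  obtain ⟨q, rfl⟩ : ∃ q, p = q + 1 := ⟨p - 1, by have := h.one_le; omega⟩
  have hA : 0 ≤ A := h.d_zero ▸ h.nonneg 0
  have h01 := h.anti zero_le_one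
  rw [Finset.sum_range_add, Finset.sum_range_succ]
  have e1 : ∑ k ∈ Finset.range q, |a (k + 2) - 2 * a (k + 1) + a k| = 0 := by
    refine Finset.sum_eq_zero fun k hk => ?_
    have hk := Finset.mem_range.1 hk
    rw [h.linear _ (by omega), h.linear _ (by omega), h.linear _ (by omega), abs_eq_zero]
    push_cast
    ring
  have e2 : |a (q + 2) - 2 * a (q + 1) + a q| ≤ A / (q + 1 : ℕ) + (d 0 - d 1) := by
    have t1 : a (q + 2) = d 1 := by rw [← h.tail 1]
    have t0 : a (q + 1) = d 0 := by rw [← h.tail 0]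
    have tq : a q = A - A / (q + 1 : ℕ) := by
      rw [h.linear q (by omega)]
      push_cast
      field_simp
      ring
    rw [t1, t0, tq, h.d_zero]
    have : 0 ≤ A / (q + 1 : ℕ) := by positivity
    rw [h.d_zero] at h01
    rw [abs_le]
    constructor <;> linarith
  have e3 : ∑ j ∈ Finset.range M, |a (q + 1 + j + 2) - 2 * a (q + 1 + j + 1) + a (q + 1 + j)| ≤
      d 0 - d 1 := by
    have : ∀ j ∈ Finset.range M,
        |a (q + 1 + j + 2) - 2 * a (q + 1 + j + 1) + a (q + 1 + j)| =
          (d j - d (j + 1)) - (d (j + 1) - d (j + 1 + 1)) := by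
      intro j _
      rw [add_assoc (q + 1) j 2, add_assoc (q + 1) j 1, h.tail, h.tail, h.tail,
        abs_of_nonneg (h.convex j)]
      ring
    rw [Finset.sum_congr rfl this, Finset.sum_range_sub' (fun j => d j - d (j + 1))]
    have := h.anti M.le_succ
    simp only [zero_add]
    linarith
  linarith

theorem sq_mul_norm_sum_le (h : LinearThenConvex A p M a d) {z : ℂ} (hz : ‖z‖ = 1) :
    ‖1 - z‖ ^ 2 * ‖∑ k ∈ Finset.range (p + M), (a k : ℂ) * z ^ k‖ ≤
      2 * (A / p + (d 0 - d 1)) := by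
  have hA : 0 ≤ A := h.d_zero ▸ h.nonneg 0
  have a0 : a 0 = 0 := by simp [h.linear 0 (by omega)]
  have a1 : a 1 = A / p := by simp [h.linear 1 h.one_le]
  have aR : a (p + M) = 0 := by rw [h.tail, h.vanish M le_rfl]
  have aR1 : a (p + M + 1) = 0 := by rw [add_assoc, h.tail, h.vanish (M + 1) (by omega)]
  rw [← norm_pow, ← norm_mul, one_sub_sq_mul_sum, a0, a1, aR, aR1]
  simp only [Complex.ofReal_zero, zero_mul, zero_add, sub_zero]
  refine (norm_add_le _ _).trans ?_
  have h1 := norm_sum_mul_le hz (fun k => k + 2) (fun k => a (k + 2) - 2 * a (k + 1) + a k) (p + M)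
  have h2 := h.sum_abs_second_difference_le
  have h3 : ‖((A / p : ℝ) : ℂ) * z‖ = A / p := by
    rw [norm_mul, hz, mul_one, Complex.norm_real, Real.norm_of_nonneg (by positivity)]
  linarith

theorem norm_tail_sum_le (h : LinearThenConvex A p M a d) {t : ℝ} (ht0 : 0 < t) (ht : t ≤ π) :
    ‖∑ j ∈ Finset.range M, (d j : ℂ) * Complex.exp (t * Complex.I) ^ j‖ ≤
      4 * (1 + π) * ∑ j ∈ Finset.range M, d j * (1 / (1 + j * t) ^ 2) := by
  set z := Complex.exp (t * Complex.I) with hzdef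
  have hz : ‖z‖ = 1 := Complex.norm_exp_ofReal_mul_I t
  set m := ⌈1 / t⌉₊ with hm
  have hmt : 1 / t ≤ m := Nat.le_ceil _
  have hzt := two_div_pi_mul_le_norm_one_sub_exp ht0.le ht
  have ext : ∀ F : ℕ → ℝ, ∑ j ∈ Finset.range (m + M), d j * F j =
      ∑ j ∈ Finset.range M, d j * F j := by
    intro F
    rw [add_comm, Finset.sum_range_add]
    simp [fun j => h.vanish (M + j) (by omega)]
  have extC : ∑ j ∈ Finset.range (m + M), (d j : ℂ) * z ^ j =
      ∑ j ∈ Finset.range M, (d j : ℂ) * z ^ j := by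
    rw [add_comm, Finset.sum_range_add]
    simp [fun j => h.vanish (M + j) (by omega)]
  have hS : ∑ j ∈ Finset.range m, d j ≤
      4 * ∑ j ∈ Finset.range M, d j * (1 / (1 + j * t) ^ 2) := by
    rw [← ext, Finset.sum_range_add, mul_add, Finset.mul_sum]
    have hnn : 0 ≤ 4 * ∑ j ∈ Finset.range M, d (m + j) * (1 / (1 + (m + j : ℕ) * t) ^ 2) :=
      mul_nonneg (by norm_num) (Finset.sum_nonneg fun j _ => mul_nonneg (h.nonneg _) (by positivity))
    refine le_add_of_le_of_nonneg (Finset.sum_le_sum fun j hj => ?_) hnn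
    have hj1 : (j : ℝ) < 1 / t := Nat.lt_ceil.1 (Finset.mem_range.1 hj)
    have hj2 : (j : ℝ) * t ≤ 1 := ((lt_div_iff₀ ht0).1 hj1).le
    have hj3 : (1 + (j : ℝ) * t) ^ 2 ≤ 4 := by
      have : (0 : ℝ) ≤ j * t := by positivity
      nlinarith
    have hj4 : 1 ≤ 4 * (1 / (1 + (j : ℝ) * t) ^ 2) := by
      rw [mul_one_div, le_div_iff₀ (by positivity)]
      linarith
    calc d j = d j * 1 := (mul_one _).symm
      _ ≤ d j * (4 * (1 / (1 + (j : ℝ) * t) ^ 2)) := mul_le_mul_of_nonneg_left hj4 (h.nonneg j)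
      _ = _ := by ring
  have hhead : ‖∑ j ∈ Finset.range m, (d j : ℂ) * z ^ j‖ ≤ ∑ j ∈ Finset.range m, d j := by
    refine (norm_sum_mul_le hz (fun j => j) d m).trans_eq ?_
    exact Finset.sum_congr rfl fun j _ => abs_of_nonneg (h.nonneg j)
  have htail : ‖∑ j ∈ Finset.range M, (d (m + j) : ℂ) * z ^ (m + j)‖ ≤
      π * ∑ j ∈ Finset.range m, d j := by
    have e1 : ∑ j ∈ Finset.range M, (d (m + j) : ℂ) * z ^ (m + j) =
        z ^ m * ∑ j ∈ Finset.range M, (d (m + j) : ℂ) * z ^ j := by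
      rw [Finset.mul_sum]
      exact Finset.sum_congr rfl fun j _ => by ring
    rw [e1, norm_mul, norm_pow, hz, one_pow, one_mul]
    have e2 := norm_one_sub_mul_sum_le (d := fun j => d (m + j))
      (fun i j hij => h.anti (by omega)) (fun j => h.nonneg _) hz M
    simp only [add_zero] at e2
    set X := ‖∑ j ∈ Finset.range M, (d (m + j) : ℂ) * z ^ j‖
    have e3 : 2 / π * t * X ≤ 2 * d m := (mul_le_mul_of_nonneg_right hzt (norm_nonneg _)).trans e2
    have e4 : m * d m ≤ ∑ j ∈ Finset.range m, d j := by
      rw [← nsmul_eq_mul]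
      simpa using Finset.card_nsmul_le_sum (Finset.range m) d (d m)
        fun j hj => h.anti (Finset.mem_range.1 hj).le
    have e5 : X ≤ π * (1 / t * d m) := by
      have : 2 / π * t * X = 2 * (X / (π * (1 / t))) := by field_simp
      rw [this] at e3
      have := (div_le_iff₀ (by positivity)).1 (by linarith : X / (π * (1 / t)) ≤ d m)
      linarith
    refine e5.trans (mul_le_mul_of_nonneg_left ?_ pi_pos.le)
    exact (mul_le_mul_of_nonneg_right hmt (h.nonneg m)).trans e4
  rw [← extC, Finset.sum_range_add]
  refine (norm_add_le _ _).trans ?_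
  have : (1 + π) * ∑ j ∈ Finset.range m, d j ≤
      (1 + π) * (4 * ∑ j ∈ Finset.range M, d j * (1 / (1 + j * t) ^ 2)) :=
    mul_le_mul_of_nonneg_left hS (by positivity)
  linarith

theorem norm_sum_le (h : LinearThenConvex A p M a d) {t : ℝ} (ht0 : 0 < t) (ht : t ≤ π) :
    ‖∑ k ∈ Finset.range (p + M), (a k : ℂ) * Complex.exp (t * Complex.I) ^ k‖ ≤
      p * A + 4 * (1 + π) * ∑ j ∈ Finset.range M, d j * (1 / (1 + j * t) ^ 2) := by
  have hz : ‖Complex.exp (t * Complex.I)‖ = 1 := Complex.norm_exp_ofReal_mul_I t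
  have hA : 0 ≤ A := h.d_zero ▸ h.nonneg 0
  have hp : (0 : ℝ) < p := by exact_mod_cast h.one_le
  rw [Finset.sum_range_add]
  refine (norm_add_le _ _).trans (add_le_add ?_ ?_)
  · refine (norm_sum_mul_le hz (fun k => k) a p).trans ?_
    rw [← nsmul_eq_mul]
    refine (Finset.sum_le_card_nsmul _ _ A fun k hk => ?_).trans_eq (by simp)
    have hk := (Finset.mem_range.1 hk).le
    rw [h.linear k hk, abs_of_nonneg (by positivity), div_le_iff₀ hp]
    gcongr
  · have : ∑ j ∈ Finset.range M, (a (p + j) : ℂ) * Complex.exp (t * Complex.I) ^ (p + j) =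
        Complex.exp (t * Complex.I) ^ p *
          ∑ j ∈ Finset.range M, (d j : ℂ) * Complex.exp (t * Complex.I) ^ j := by
      rw [Finset.mul_sum]
      exact Finset.sum_congr rfl fun j _ => by rw [h.tail, pow_add]; ring
    rw [this, norm_mul, norm_pow, hz, one_pow, one_mul]
    exact h.norm_tail_sum_le ht0 ht

end LinearThenConvex

theorem integral_one_div_one_add_mul_sq {c b : ℝ} (hc : 0 ≤ c) (hb : 0 ≤ b) :
    ∫ t in (0 : ℝ)..b, 1 / (1 + c * t) ^ 2 = b / (1 + c * b) := by
  have hpos : ∀ t ∈ uIcc 0 b, 0 < 1 + c * t := fun t ht => by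
    rw [uIcc_of_le hb] at ht
    have := mul_nonneg hc ht.1
    linarith
  rw [intervalIntegral.integral_eq_sub_of_hasDerivAt (f := fun t => t / (1 + c * t))]
  · simp
  · intro t ht
    have hne := (hpos t ht).ne'
    have h1 : HasDerivAt (fun t => 1 + c * t) c t := by
      simpa using ((hasDerivAt_id t).const_mul c).const_add 1
    exact ((hasDerivAt_id t).div h1 hne).congr_deriv (by simp only [id]; ring)
  · refine ContinuousOn.intervalIntegrable ?_
    exact continuousOn_const.div (by fun_prop) fun t ht => (pow_pos (hpos t ht) 2).ne'

theorem LinearThenConvex.integral_norm_sum_le {A : ℝ} {p M : ℕ} {a d : ℕ → ℝ}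
    (h : LinearThenConvex A p M a d) :
    ∫ t in (0 : ℝ)..π,
        ‖∑ k ∈ Finset.range (p + M), (a k : ℂ) * Complex.exp (t * Complex.I) ^ k‖ ≤
      A + 4 * (1 + π) * ∑ j ∈ Finset.range M, d j / (p + j) +
        π ^ 2 / 2 * (A + p * (d 0 - d 1)) := by
  have hA : 0 ≤ A := h.d_zero ▸ h.nonneg 0
  have hp1 : (1 : ℝ) ≤ p := by exact_mod_cast h.one_le
  have hp : (0 : ℝ) < p := by linarith
  have hpi : 1 / (p : ℝ) ≤ π := by
    have : 1 / (p : ℝ) ≤ 1 := by rw [div_le_one hp]; exact hp1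
    linarith [pi_gt_three]
  set G : ℝ → ℝ := fun t =>
    ‖∑ k ∈ Finset.range (p + M), (a k : ℂ) * Complex.exp (t * Complex.I) ^ k‖ with hG
  have hGc : Continuous G := by rw [hG]; fun_prop
  have hp0 : 0 < 1 / (p : ℝ) := by positivity
  have cpos : ∀ j : ℕ, ContinuousOn (fun t : ℝ => 1 / (1 + (j : ℝ) * t) ^ 2) (Icc 0 (1 / p)) := by
    intro j
    refine continuousOn_const.div (by fun_prop) fun t ht => ?_
    have := mul_nonneg (Nat.cast_nonneg (α := ℝ) j) ht.1
    positivity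
  have cpos' : ∀ j : ℕ,
      IntervalIntegrable (fun t : ℝ => d j * (1 / (1 + (j : ℝ) * t) ^ 2)) volume 0 (1 / p) := by
    intro j
    refine ContinuousOn.intervalIntegrable ?_
    rw [uIcc_of_le hp0.le]
    exact continuousOn_const.mul (cpos j)
  have hsumint : IntervalIntegrable
      (fun t : ℝ => ∑ j ∈ Finset.range M, d j * (1 / (1 + (j : ℝ) * t) ^ 2)) volume 0 (1 / p) := by
    refine ContinuousOn.intervalIntegrable ?_
    rw [uIcc_of_le hp0.le]
    exact continuousOn_finsetSum _ fun j _ => continuousOn_const.mul (cpos j)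
  have I1 : ∫ t in (0 : ℝ)..(1 / p), G t ≤
      A + 4 * (1 + π) * ∑ j ∈ Finset.range M, d j / (p + j) := by
    have hle : ∫ t in (0 : ℝ)..(1 / p), G t ≤ ∫ t in (0 : ℝ)..(1 / p), (p * A +
        4 * (1 + π) * ∑ j ∈ Finset.range M, d j * (1 / (1 + (j : ℝ) * t) ^ 2)) := by
      refine intervalIntegral.integral_mono_on_of_le_Ioo hp0.le (hGc.intervalIntegrable _ _)
        (intervalIntegrable_const.add (hsumint.const_mul _)) fun t ht => ?_
      exact h.norm_sum_le ht.1 (ht.2.le.trans hpi)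
    refine hle.trans_eq ?_
    rw [intervalIntegral.integral_add intervalIntegrable_const (hsumint.const_mul _),
      intervalIntegral.integral_const, intervalIntegral.integral_const_mul,
      intervalIntegral.integral_finsetSum fun j _ => cpos' j]
    congr 1
    · simp only [sub_zero, smul_eq_mul]
      field_simp
    · congr 1
      refine Finset.sum_congr rfl fun j _ => ?_
      rw [intervalIntegral.integral_const_mul,
        integral_one_div_one_add_mul_sq (Nat.cast_nonneg j) hp0.le]
      field_simp
  set B := A / p + (d 0 - d 1) with hB
  have hB0 : 0 ≤ B := add_nonneg (by positivity) (sub_nonneg.2 (h.anti zero_le_one))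
  have I2 : ∫ t in (1 / (p : ℝ))..π, G t ≤ π ^ 2 / 2 * (A + p * (d 0 - d 1)) := by
    have hne : (0 : ℝ) ∉ uIcc (1 / (p : ℝ)) π := by
      rw [uIcc_of_le hpi]
      exact fun h0 => absurd h0.1 (not_le.2 hp0)
    have hint : IntervalIntegrable (fun t : ℝ => t ^ (-2 : ℤ)) volume (1 / (p : ℝ)) π :=
      intervalIntegral.intervalIntegrable_zpow (Or.inr hne)
    have hle : ∫ t in (1 / (p : ℝ))..π, G t ≤
        ∫ t in (1 / (p : ℝ))..π, (π ^ 2 / 2 * B) * t ^ (-2 : ℤ) := by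
      refine intervalIntegral.integral_mono_on hpi (hGc.intervalIntegrable _ _)
        (hint.const_mul _) fun t ht => ?_
      have ht0 : 0 < t := hp0.trans_le ht.1
      have h1 := h.sq_mul_norm_sum_le (Complex.norm_exp_ofReal_mul_I t)
      have h2 := two_div_pi_mul_le_norm_one_sub_exp ht0.le ht.2
      have h3 : (2 / π * t) ^ 2 ≤ ‖1 - Complex.exp (t * Complex.I)‖ ^ 2 := by gcongr
      have h4 : (2 / π * t) ^ 2 * G t ≤ 2 * B :=
        (mul_le_mul_of_nonneg_right h3 (norm_nonneg _)).trans h1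
      have h5 : (2 / π * t) ^ 2 * G t = 2 * (G t / (π ^ 2 / 2 * t ^ (-2 : ℤ))) := by
        rw [zpow_neg, zpow_ofNat]
        field_simp
      rw [h5] at h4
      have := (div_le_iff₀ (by positivity)).1
        (by linarith : G t / (π ^ 2 / 2 * t ^ (-2 : ℤ)) ≤ B)
      linarith
    refine hle.trans ?_
    rw [intervalIntegral.integral_const_mul, integral_zpow (Or.inr ⟨by norm_num, hne⟩)]
    have e1 : (π ^ ((-2 : ℤ) + 1) - (1 / (p : ℝ)) ^ ((-2 : ℤ) + 1)) / (((-2 : ℤ) : ℝ) + 1) =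
        p - 1 / π := by
      norm_num
      ring
    rw [e1]
    have e2 : π ^ 2 / 2 * B * (p - 1 / π) ≤ π ^ 2 / 2 * B * p := by
      apply mul_le_mul_of_nonneg_left _ (by positivity)
      have : 0 ≤ 1 / π := by positivity
      linarith
    refine e2.trans_eq ?_
    rw [hB]
    field_simp
  rw [← intervalIntegral.integral_add_adjacent_intervals (hGc.intervalIntegrable 0 (1 / (p : ℝ)))
    (hGc.intervalIntegrable _ _)]
  linarith

theorem integral_cos_int_mul (m : ℤ) :
    ∫ x in (-π)..π, Real.cos (m * x) = if m = 0 then 2 * π else 0 := by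
  split_ifs with hm
  · subst hm
    simp
    ring
  · have hm' : (m : ℝ) ≠ 0 := by exact_mod_cast hm
    rw [intervalIntegral.integral_comp_mul_left (fun x => Real.cos x) hm', integral_cos]
    simp [Real.sin_int_mul_pi]

theorem integral_sin_int_mul (m : ℤ) : ∫ x in (-π)..π, Real.sin (m * x) = 0 := by
  by_cases hm : m = 0
  · simp [hm]
  · have hm' : (m : ℝ) ≠ 0 := by exact_mod_cast hm
    rw [intervalIntegral.integral_comp_mul_left (fun x => Real.sin x) hm', integral_sin]
    simp

theorem integral_cos_mul_cos (k j : ℕ) :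
    ∫ x in (-π)..π, Real.cos (k * x) * Real.cos (j * x) =
      if k = j then (if k = 0 then 2 * π else π) else 0 := by
  have e : ∀ x : ℝ, Real.cos (k * x) * Real.cos (j * x) =
      (Real.cos (((k - j : ℤ) : ℝ) * x) + Real.cos (((k + j : ℤ) : ℝ) * x)) / 2 := by
    intro x
    push_cast
    rw [sub_mul, add_mul, Real.cos_sub, Real.cos_add]
    ring
  simp_rw [e]
  rw [intervalIntegral.integral_div, intervalIntegral.integral_add
    (Continuous.intervalIntegrable (by fun_prop) _ _)
    (Continuous.intervalIntegrable (by fun_prop) _ _), integral_cos_int_mul, integral_cos_int_mul]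
  split_ifs <;> first | omega | (ring)

theorem integral_sin_mul_sin (k j : ℕ) :
    ∫ x in (-π)..π, Real.sin (k * x) * Real.sin (j * x) =
      if k = j then (if k = 0 then 0 else π) else 0 := by
  have e : ∀ x : ℝ, Real.sin (k * x) * Real.sin (j * x) =
      (Real.cos (((k - j : ℤ) : ℝ) * x) - Real.cos (((k + j : ℤ) : ℝ) * x)) / 2 := by
    intro x
    push_cast
    rw [sub_mul, add_mul, Real.cos_sub, Real.cos_add]
    ring
  simp_rw [e]
  rw [intervalIntegral.integral_div, intervalIntegral.integral_sub
    (Continuous.intervalIntegrable (by fun_prop) _ _)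
    (Continuous.intervalIntegrable (by fun_prop) _ _), integral_cos_int_mul, integral_cos_int_mul]
  split_ifs <;> first | omega | (ring)

theorem integral_sin_mul_cos (k j : ℕ) :
    ∫ x in (-π)..π, Real.sin (k * x) * Real.cos (j * x) = 0 := by
  have e : ∀ x : ℝ, Real.sin (k * x) * Real.cos (j * x) =
      (Real.sin (((k - j : ℤ) : ℝ) * x) + Real.sin (((k + j : ℤ) : ℝ) * x)) / 2 := by
    intro x
    push_cast
    rw [sub_mul, add_mul, Real.sin_sub, Real.sin_add]
    ring
  simp_rw [e]
  rw [intervalIntegral.integral_div, intervalIntegral.integral_add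
    (Continuous.intervalIntegrable (by fun_prop) _ _)
    (Continuous.intervalIntegrable (by fun_prop) _ _), integral_sin_int_mul, integral_sin_int_mul]
  simp

theorem fourierA_trig (a b : ℝ) (k j : ℕ) :
    fourierA (fun x => a * Real.cos (k * x) + b * Real.sin (k * x)) j =
      if k = j then (if k = 0 then 2 * a else a) else 0 := by
  have e : ∀ x : ℝ, (a * Real.cos (k * x) + b * Real.sin (k * x)) * Real.cos (j * x) =
      a * (Real.cos (k * x) * Real.cos (j * x)) + b * (Real.sin (k * x) * Real.cos (j * x)) :=
    fun x => by ring
  unfold fourierA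
  simp_rw [e]
  rw [intervalIntegral.integral_add (Continuous.intervalIntegrable (by fun_prop) _ _)
    (Continuous.intervalIntegrable (by fun_prop) _ _), intervalIntegral.integral_const_mul,
    intervalIntegral.integral_const_mul, integral_cos_mul_cos, integral_sin_mul_cos]
  split_ifs <;> field_simp <;> ring

theorem fourierB_trig (a b : ℝ) (k j : ℕ) :
    fourierB (fun x => a * Real.cos (k * x) + b * Real.sin (k * x)) j =
      if k = j then (if k = 0 then 0 else b) else 0 := by
  have e : ∀ x : ℝ, (a * Real.cos (k * x) + b * Real.sin (k * x)) * Real.sin (j * x) =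
      a * (Real.sin (j * x) * Real.cos (k * x)) + b * (Real.sin (k * x) * Real.sin (j * x)) :=
    fun x => by ring
  unfold fourierB
  simp_rw [e]
  rw [intervalIntegral.integral_add (Continuous.intervalIntegrable (by fun_prop) _ _)
    (Continuous.intervalIntegrable (by fun_prop) _ _), intervalIntegral.integral_const_mul,
    intervalIntegral.integral_const_mul, integral_sin_mul_sin, integral_sin_mul_cos]
  split_ifs <;> field_simp <;> ring

theorem harmonicTerm_eq (f : ℝ → ℝ) (k : ℕ) (x : ℝ) :
    harmonicTerm f k x = (if k = 0 then fourierA f 0 / 2 else fourierA f k) * Real.cos (k * x) +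
      fourierB f k * Real.sin (k * x) := by
  unfold harmonicTerm
  split_ifs with h
  · simp [h]
  · rfl

theorem continuous_harmonicTerm (f : ℝ → ℝ) (k : ℕ) : Continuous (harmonicTerm f k) := by
  rw [funext (harmonicTerm_eq f k)]
  fun_prop

theorem continuous_sum_harmonicTerm (f : ℝ → ℝ) (m : ℕ → ℝ) (R : ℕ) :
    Continuous fun x => ∑ k ∈ Finset.range R, m k * harmonicTerm f k x :=
  continuous_finsetSum _ fun k _ => continuous_const.mul (continuous_harmonicTerm f k)

theorem periodic2pi_harmonicTerm (f : ℝ → ℝ) (k : ℕ) : Periodic2pi (harmonicTerm f k) := by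
  intro x
  have e : (k : ℝ) * (x + 2 * π) = k * x + k * (2 * π) := by ring
  rw [harmonicTerm_eq, harmonicTerm_eq, e, Real.cos_add_nat_mul_two_pi,
    Real.sin_add_nat_mul_two_pi]

theorem fourierA_harmonicTerm (f : ℝ → ℝ) (k j : ℕ) :
    fourierA (harmonicTerm f k) j = if k = j then fourierA f j else 0 := by
  rw [funext (harmonicTerm_eq f k), fourierA_trig]
  split_ifs with h1 h2
  · subst h1; subst h2; ring
  · rw [h1]
  · rfl

theorem fourierB_harmonicTerm (f : ℝ → ℝ) (k j : ℕ) :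
    fourierB (harmonicTerm f k) j = if k = j then fourierB f j else 0 := by
  rw [funext (harmonicTerm_eq f k), fourierB_trig]
  split_ifs with h1 h2
  · subst h1; subst h2; simp [fourierB]
  · rw [h1]
  · rfl

theorem fourierA_sum_harmonicTerm (f : ℝ → ℝ) (m : ℕ → ℝ) (R j : ℕ) :
    fourierA (fun x => ∑ k ∈ Finset.range R, m k * harmonicTerm f k x) j =
      if j < R then m j * fourierA f j else 0 := by
  have e : ∀ k, (1 / π) * ∫ t in (-π)..π, m k * (harmonicTerm f k t * Real.cos (j * t)) =
      m k * if k = j then fourierA f j else 0 := fun k => by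
    rw [intervalIntegral.integral_const_mul, ← fourierA_harmonicTerm f k j, fourierA]
    ring
  have hint : ∀ k ∈ Finset.range R, IntervalIntegrable
      (fun t => m k * (harmonicTerm f k t * Real.cos (j * t))) volume (-π) π := fun k _ =>
    (continuous_const.mul ((continuous_harmonicTerm f k).mul (by fun_prop))).intervalIntegrable _ _
  unfold fourierA
  simp_rw [Finset.sum_mul, mul_assoc]
  rw [intervalIntegral.integral_finsetSum hint, Finset.mul_sum, Finset.sum_congr rfl fun k _ => e k]
  simp [fourierA]

theorem fourierB_sum_harmonicTerm (f : ℝ → ℝ) (m : ℕ → ℝ) (R j : ℕ) :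
    fourierB (fun x => ∑ k ∈ Finset.range R, m k * harmonicTerm f k x) j =
      if j < R then m j * fourierB f j else 0 := by
  have e : ∀ k, (1 / π) * ∫ t in (-π)..π, m k * (harmonicTerm f k t * Real.sin (j * t)) =
      m k * if k = j then fourierB f j else 0 := fun k => by
    rw [intervalIntegral.integral_const_mul, ← fourierB_harmonicTerm f k j, fourierB]
    ring
  have hint : ∀ k ∈ Finset.range R, IntervalIntegrable
      (fun t => m k * (harmonicTerm f k t * Real.sin (j * t))) volume (-π) π := fun k _ =>
    (continuous_const.mul ((continuous_harmonicTerm f k).mul (by fun_prop))).intervalIntegrable _ _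
  unfold fourierB
  simp_rw [Finset.sum_mul, mul_assoc]
  rw [intervalIntegral.integral_finsetSum hint, Finset.mul_sum, Finset.sum_congr rfl fun k _ => e k]
  simp [fourierB]

theorem fourierA_sub {f g : ℝ → ℝ} (hf : Continuous f) (hg : Continuous g) (k : ℕ) :
    fourierA (fun x => f x - g x) k = fourierA f k - fourierA g k := by
  unfold fourierA
  simp_rw [sub_mul]
  rw [intervalIntegral.integral_sub (Continuous.intervalIntegrable (by fun_prop) _ _)
    (Continuous.intervalIntegrable (by fun_prop) _ _)]
  ring

theorem fourierB_sub {f g : ℝ → ℝ} (hf : Continuous f) (hg : Continuous g) (k : ℕ) :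
    fourierB (fun x => f x - g x) k = fourierB f k - fourierB g k := by
  unfold fourierB
  simp_rw [sub_mul]
  rw [intervalIntegral.integral_sub (Continuous.intervalIntegrable (by fun_prop) _ _)
    (Continuous.intervalIntegrable (by fun_prop) _ _)]
  ring

theorem tendsto_integral_mul_fourier {w : ℕ → ℝ → ℝ} (hw : ∀ N, Continuous (w N))
    (hA : ∀ k, Tendsto (fun N => fourierA (w N) k) atTop (nhds 0))
    (hB : ∀ k, Tendsto (fun N => fourierB (w N) k) atTop (nhds 0)) (n : ℤ) :
    Tendsto (fun N => ∫ x in (-π)..π, (w N x : ℂ) * fourier n (x : AddCircle (2 * π))) atTop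
      (nhds 0) := by
  have key : ∀ s : ℝ, ∀ k : ℕ, (n : ℝ) = s * k → (s = 1 ∨ s = -1) →
      ∀ N, ∫ x in (-π)..π, (w N x : ℂ) * fourier n (x : AddCircle (2 * π)) =
        ((π * fourierA (w N) k : ℝ) : ℂ) + ((s * (π * fourierB (w N) k) : ℝ) : ℂ) * Complex.I := by
    intro s k hn hs N
    have hc := hw N
    have e : ∀ x : ℝ, (w N x : ℂ) * fourier n (x : AddCircle (2 * π)) =
        ((w N x * Real.cos (k * x) : ℝ) : ℂ) +
          ((s * (w N x * Real.sin (k * x)) : ℝ) : ℂ) * Complex.I := by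
      intro x
      rw [fourier_coe_apply]
      have e1 : 2 * (π : ℂ) * Complex.I * n * x / ((2 * π : ℝ) : ℂ) =
          ((s * (k * x) : ℝ) : ℂ) * Complex.I := by
        have : (n : ℂ) = ((n : ℝ) : ℂ) := by simp
        rw [this, hn]
        have hpi : (π : ℂ) ≠ 0 := by exact_mod_cast pi_ne_zero
        push_cast
        field_simp
      rw [e1, Complex.exp_mul_I, ← Complex.ofReal_cos, ← Complex.ofReal_sin]
      rcases hs with rfl | rfl
      · push_cast; simp; ring
      · push_cast; simp; ring
    simp_rw [e]
    rw [intervalIntegral.integral_add (Continuous.intervalIntegrable (by fun_prop) _ _)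
      (Continuous.intervalIntegrable (by fun_prop) _ _), intervalIntegral.integral_mul_const,
      intervalIntegral.integral_ofReal, intervalIntegral.integral_ofReal,
      intervalIntegral.integral_const_mul]
    unfold fourierA fourierB
    congr 3 <;> field_simp
  have fin : ∀ s : ℝ, ∀ k : ℕ, Tendsto (fun N => ((π * fourierA (w N) k : ℝ) : ℂ) +
      ((s * (π * fourierB (w N) k) : ℝ) : ℂ) * Complex.I) atTop (nhds 0) := by
    intro s k
    have h1 := ((hA k).const_mul π).ofReal
    have h2 := (((hB k).const_mul π).const_mul s).ofReal.mul_const Complex.I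
    simpa using h1.add h2
  obtain ⟨k, rfl | rfl⟩ := n.eq_nat_or_neg
  · rw [funext (key 1 k (by simp) (Or.inl rfl))]
    exact fin 1 k
  · rw [funext (key (-1) k (by simp) (Or.inr rfl))]
    exact fin (-1) k

theorem tendsto_integral_mul_of_fourier {w : ℕ → ℝ → ℝ} (hw : ∀ N, Continuous (w N)) {D : ℝ}
    (hD : ∀ N, ∀ x ∈ Icc (-π) π, |w N x| ≤ D)
    (hA : ∀ k, Tendsto (fun N => fourierA (w N) k) atTop (nhds 0))
    (hB : ∀ k, Tendsto (fun N => fourierB (w N) k) atTop (nhds 0))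
    {h : ℝ → ℝ} (hc : Continuous h) (hper : Periodic2pi h) :
    Tendsto (fun N => ∫ x in (-π)..π, w N x * h x) atTop (nhds 0) := by
  have : Fact (0 < 2 * π) := ⟨two_pi_pos⟩
  have hper' : Function.Periodic h (2 * π) := hper
  let H : C(AddCircle (2 * π), ℂ) :=
    ⟨fun y => ((hper'.lift y : ℝ) : ℂ), Complex.continuous_ofReal.comp
      (continuous_coinduced_dom.mpr hc)⟩
  have hH : ∀ x : ℝ, H (x : AddCircle (2 * π)) = (h x : ℂ) := fun x => by
    simp [H]
  have hcoe : Continuous fun x : ℝ => (x : AddCircle (2 * π)) := AddCircle.continuous_mk' _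
  have hint : ∀ (b : C(AddCircle (2 * π), ℂ)) (N : ℕ), IntervalIntegrable
      (fun x : ℝ => (w N x : ℂ) * b (x : AddCircle (2 * π))) volume (-π) π := fun b N =>
    ((Complex.continuous_ofReal.comp (hw N)).mul (b.continuous.comp hcoe)).intervalIntegrable _ _
  have hspan : ∀ b ∈ Submodule.span ℂ (Set.range (@fourier (2 * π))),
      Tendsto (fun N => ∫ x in (-π)..π, (w N x : ℂ) * b (x : AddCircle (2 * π))) atTop
        (nhds 0) := by
    intro b hb
    induction hb using Submodule.span_induction with
    | mem b hb =>
      obtain ⟨n, rfl⟩ := hb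
      exact tendsto_integral_mul_fourier hw hA hB n
    | zero => simp
    | add b c _ _ hb hc =>
      have e : ∀ N, ∫ x in (-π)..π, (w N x : ℂ) * (b + c) (x : AddCircle (2 * π)) =
          (∫ x in (-π)..π, (w N x : ℂ) * b (x : AddCircle (2 * π))) +
            ∫ x in (-π)..π, (w N x : ℂ) * c (x : AddCircle (2 * π)) := fun N => by
        rw [← intervalIntegral.integral_add (hint b N) (hint c N)]
        simp [mul_add]
      simp_rw [e]
      simpa using hb.add hc
    | smul r b _ hb =>
      have e : ∀ N, ∫ x in (-π)..π, (w N x : ℂ) * (r • b) (x : AddCircle (2 * π)) =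
          r * ∫ x in (-π)..π, (w N x : ℂ) * b (x : AddCircle (2 * π)) := fun N => by
        rw [← intervalIntegral.integral_const_mul]
        simp [mul_left_comm]
      simp_rw [e]
      simpa using hb.const_mul r
  have hD0 : 0 ≤ D := (abs_nonneg _).trans (hD 0 0 ⟨by linarith [pi_pos], pi_pos.le⟩)
  have hdense : H ∈ closure (Submodule.span ℂ (Set.range (@fourier (2 * π))) :
      Set C(AddCircle (2 * π), ℂ)) := by
    rw [← Submodule.topologicalClosure_coe, span_fourier_closure_eq_top]
    trivial
  rw [Metric.tendsto_atTop]
  intro ε hε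
  obtain ⟨b, hb, hHb⟩ := Metric.mem_closure_iff.1 hdense (ε / (2 * (2 * π * D + 1)))
    (by positivity)
  obtain ⟨N₀, hN₀⟩ := Metric.tendsto_atTop.1 (hspan b hb) (ε / 2) (by positivity)
  refine ⟨N₀, fun N hN => ?_⟩
  have h1 := hN₀ N hN
  rw [dist_zero_right] at h1 ⊢
  have e : ((∫ x in (-π)..π, w N x * h x : ℝ) : ℂ) =
      (∫ x in (-π)..π, (w N x : ℂ) * b (x : AddCircle (2 * π))) +
        ∫ x in (-π)..π, (w N x : ℂ) * (H - b) (x : AddCircle (2 * π)) := by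
    rw [← intervalIntegral.integral_add (hint b N) (hint (H - b) N),
      ← intervalIntegral.integral_ofReal]
    refine intervalIntegral.integral_congr fun x _ => ?_
    simp [hH]
    ring
  have h2 : ‖∫ x in (-π)..π, (w N x : ℂ) * (H - b) (x : AddCircle (2 * π))‖ ≤
      D * (ε / (2 * (2 * π * D + 1))) * |π - -π| := by
    refine intervalIntegral.norm_integral_le_of_norm_le_const fun x hx => ?_
    rw [uIoc_of_le (by linarith [pi_pos])] at hx
    rw [norm_mul, Complex.norm_real, Real.norm_eq_abs]
    refine mul_le_mul (hD N x ⟨hx.1.le, hx.2⟩) ?_ (norm_nonneg _) hD0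
    rw [dist_eq_norm] at hHb
    exact ((H - b).norm_coe_le_norm _).trans hHb.le
  have h3 : D * (ε / (2 * (2 * π * D + 1))) * |π - -π| ≤ ε / 2 := by
    rw [abs_of_pos (by linarith [pi_pos])]
    have : D * (ε / (2 * (2 * π * D + 1))) * (π - -π) =
        ε / 2 * ((2 * π * D) / (2 * π * D + 1)) := by
      field_simp
      ring
    rw [this]
    refine mul_le_of_le_one_right (by positivity) ?_
    rw [div_le_one (by positivity)]
    linarith
  rw [← Complex.norm_real, e]
  calc _ ≤ _ := norm_add_le _ _
    _ < ε := by linarith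

theorem le_of_fourier_tendsto {u : ℝ → ℝ} (hu : Continuous u) (hper : Periodic2pi u)
    {w : ℕ → ℝ → ℝ} (hw : ∀ N, Continuous (w N)) {C : ℝ} (hb : ∀ N x, |u x + w N x| ≤ C)
    (hA : ∀ k, Tendsto (fun N => fourierA (w N) k) atTop (nhds 0))
    (hB : ∀ k, Tendsto (fun N => fourierB (w N) k) atTop (nhds 0)) (x : ℝ) : u x ≤ C := by
  obtain ⟨D, hD⟩ := (isCompact_Icc (a := -π) (b := π)).exists_bound_of_continuousOn hu.continuousOn
  have hbw : ∀ N, ∀ x ∈ Icc (-π) π, |w N x| ≤ C + D := by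
    intro N x hx
    have h1 := abs_le.1 (hb N x)
    have h2 := abs_le.1 (hD x hx)
    rw [abs_le]
    constructor <;> linarith
  set h : ℝ → ℝ := fun x => max (u x - C) 0 with hh
  have hhc : Continuous h := by rw [hh]; fun_prop
  have hhp : Periodic2pi h := fun x => by simp only [hh, hper x]
  have hlim := tendsto_integral_mul_of_fourier hw hbw hA hB hhc hhp
  have hle : ∀ N, ∫ x in (-π)..π, w N x * h x ≤ ∫ x in (-π)..π, -(h x ^ 2) := by
    intro N
    have := hw N
    refine intervalIntegral.integral_mono_on (by linarith [pi_pos])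
      (Continuous.intervalIntegrable (by fun_prop) _ _)
      (Continuous.intervalIntegrable (by fun_prop) _ _) fun x _ => ?_
    have h1 := (abs_le.1 (hb N x)).2
    rcases le_total (u x - C) 0 with h2 | h2
    · simp [hh, max_eq_right h2]
    · simp only [hh, max_eq_left h2]
      nlinarith
  have h0 := le_of_tendsto' hlim hle
  have hzero : ∀ y ∈ Icc (-π) π, u y ≤ C := by
    intro y hy
    by_contra! hlt
    have hpos : 0 < ∫ x in (-π)..π, h x ^ 2 := by
      refine intervalIntegral.integral_pos (by linarith [pi_pos]) (by fun_prop)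
        (fun _ _ => sq_nonneg _) ⟨y, hy, ?_⟩
      have : 0 < h y := lt_max_of_lt_left (by linarith)
      positivity
    rw [intervalIntegral.integral_neg] at h0
    linarith
  have hper' : Function.Periodic u (2 * π) := hper
  obtain ⟨y, hy, hxy⟩ := hper'.exists_mem_Ico two_pi_pos x (-π)
  rw [hxy]
  exact hzero y ⟨hy.1, by linarith [hy.2]⟩

/-- Weak-limit principle: a continuous function inherits a uniform bound from functions whose
Fourier coefficients converge to its own. -/
theorem abs_le_of_fourier_tendsto {u : ℝ → ℝ} (hu : Continuous u) (hper : Periodic2pi u)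
    {v : ℕ → ℝ → ℝ} (hv : ∀ N, Continuous (v N)) {C : ℝ} (hb : ∀ N x, |v N x| ≤ C)
    (hA : ∀ k, Tendsto (fun N => fourierA (v N) k) atTop (nhds (fourierA u k)))
    (hB : ∀ k, Tendsto (fun N => fourierB (v N) k) atTop (nhds (fourierB u k))) (x : ℝ) :
    |u x| ≤ C := by
  have nA : ∀ (f : ℝ → ℝ) k, fourierA (fun x => -f x) k = -fourierA f k := fun f k => by
    simp [fourierA]
  have nB : ∀ (f : ℝ → ℝ) k, fourierB (fun x => -f x) k = -fourierB f k := fun f k => by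
    simp [fourierB]
  have hA' : ∀ k, Tendsto (fun N => fourierA (fun x => v N x - u x) k) atTop (nhds 0) := fun k => by
    simp_rw [fun N => fourierA_sub (hv N) hu k]
    simpa using (hA k).sub_const (fourierA u k)
  have hB' : ∀ k, Tendsto (fun N => fourierB (fun x => v N x - u x) k) atTop (nhds 0) := fun k => by
    simp_rw [fun N => fourierB_sub (hv N) hu k]
    simpa using (hB k).sub_const (fourierB u k)
  have hc : ∀ N, Continuous fun x => v N x - u x := fun N => (hv N).sub hu
  rw [abs_le']
  refine ⟨le_of_fourier_tendsto hu hper hc (fun N x => ?_) hA' hB' x,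
    le_of_fourier_tendsto (u := fun x => -u x) hu.neg (fun x => by simp [hper x])
      (w := fun N x => -(v N x - u x)) (fun N => (hc N).neg) (fun N x => ?_)
      (fun k => ?_) (fun k => ?_) x⟩
  · simpa using hb N x
  · rw [← abs_neg]
    simpa using hb N x
  · simpa only [nA, neg_zero] using (hA' k).neg
  · simpa only [nB, neg_zero] using (hB' k).neg

theorem SInf.intervalIntegrable_mul {φ g : ℝ → ℝ} (hφ : SInf φ) (hg : Continuous g) (a b : ℝ) :
    IntervalIntegrable (fun t => φ t * g t) volume a b := by
  refine (hg.intervalIntegrable a b).mono_fun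
    (hφ.1.mul hg.measurable).aestronglyMeasurable (ae_restrict_of_ae ?_)
  filter_upwards [hφ.2.2] with t ht
  rw [norm_mul]
  exact mul_le_of_le_one_left (norm_nonneg _) ht

theorem IsPsiDeriv.harmonicTerm_eq_integral {ψ : ℕ → ℝ} {β : ℝ} {f φ : ℝ → ℝ}
    (h : IsPsiDeriv ψ β f φ) {k : ℕ} (hk : 1 ≤ k) (hψ : ψ k ≠ 0) (x : ℝ) :
    harmonicTerm f k x =
      ψ k * ((1 / π) * ∫ t in (-π)..π, φ t * Real.cos (k * (t - x) + β * π / 2)) := by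
  set θ := β * π / 2 with hθ
  have e : ∀ t : ℝ, φ t * Real.cos (k * (t - x) + θ) =
      φ t * Real.cos (k * t) * Real.cos (θ - k * x) -
        φ t * Real.sin (k * t) * Real.sin (θ - k * x) := fun t => by
    rw [show k * (t - x) + θ = k * t + (θ - k * x) by ring, Real.cos_add]
    ring
  have hA : (1 / π) * ∫ t in (-π)..π, φ t * Real.cos (k * (t - x) + θ) =
      fourierA φ k * Real.cos (θ - k * x) - fourierB φ k * Real.sin (θ - k * x) := by
    simp_rw [e]
    rw [intervalIntegral.integral_sub
      ((h.1.intervalIntegrable_mul (by fun_prop) _ _).mul_const _)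
      ((h.1.intervalIntegrable_mul (by fun_prop) _ _).mul_const _),
      intervalIntegral.integral_mul_const, intervalIntegral.integral_mul_const]
    unfold fourierA fourierB
    ring
  obtain ⟨h1, h2⟩ := h.2.2 k hk
  rw [hA, h1, h2, harmonicTerm_eq, if_neg (by omega), Real.cos_sub, Real.sin_sub, ← hθ]
  have hs := Real.sin_sq_add_cos_sq θ
  field_simp
  linear_combination
    -(fourierA f k * Real.cos (k * x) + fourierB f k * Real.sin (k * x)) * hs

theorem abs_sum_mul_cos_le (c : ℕ → ℝ) (R : ℕ) (s θ : ℝ) :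
    |∑ k ∈ Finset.range R, c k * Real.cos (k * s + θ)| ≤
      ‖∑ k ∈ Finset.range R, (c k : ℂ) * Complex.exp (s * Complex.I) ^ k‖ := by
  have e : ∑ k ∈ Finset.range R, c k * Real.cos (k * s + θ) =
      (Complex.exp (θ * Complex.I) *
        ∑ k ∈ Finset.range R, (c k : ℂ) * Complex.exp (s * Complex.I) ^ k).re := by
    rw [Finset.mul_sum, Complex.re_sum]
    refine Finset.sum_congr rfl fun k _ => ?_
    have : Complex.exp (θ * Complex.I) * ((c k : ℂ) * Complex.exp (s * Complex.I) ^ k) =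
        (c k : ℂ) * Complex.exp (((k * s + θ : ℝ) : ℂ) * Complex.I) := by
      rw [← Complex.exp_nat_mul, mul_left_comm, ← Complex.exp_add]
      congr 2
      push_cast
      ring
    rw [this, Complex.re_ofReal_mul, Complex.exp_ofReal_mul_I_re]
  rw [e]
  refine (Complex.abs_re_le_norm _).trans_eq ?_
  rw [norm_mul, Complex.norm_exp_ofReal_mul_I, one_mul]

theorem integral_norm_sum_exp_symm (c : ℕ → ℝ) (R : ℕ) (x : ℝ) :
    ∫ t in (-π)..π,
        ‖∑ k ∈ Finset.range R, (c k : ℂ) * Complex.exp (((t - x : ℝ) : ℂ) * Complex.I) ^ k‖ =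
      2 * ∫ t in (0 : ℝ)..π,
        ‖∑ k ∈ Finset.range R, (c k : ℂ) * Complex.exp (t * Complex.I) ^ k‖ := by
  set G : ℝ → ℝ := fun t =>
    ‖∑ k ∈ Finset.range R, (c k : ℂ) * Complex.exp (t * Complex.I) ^ k‖ with hG
  have hGc : Continuous G := by rw [hG]; fun_prop
  have hper : Function.Periodic G (2 * π) := fun t => by
    have : Complex.exp (((t + 2 * π : ℝ) : ℂ) * Complex.I) = Complex.exp (t * Complex.I) := by
      push_cast
      rw [add_mul, Complex.exp_periodic]
    simp only [hG, this]
  have heven : ∀ t, G (-t) = G t := fun t => by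
    have : ∑ k ∈ Finset.range R, (c k : ℂ) * Complex.exp (((-t : ℝ) : ℂ) * Complex.I) ^ k =
        (starRingEnd ℂ) (∑ k ∈ Finset.range R, (c k : ℂ) * Complex.exp (t * Complex.I) ^ k) := by
      rw [map_sum]
      refine Finset.sum_congr rfl fun k _ => ?_
      rw [map_mul, map_pow, ← Complex.exp_conj]
      simp
    simp only [hG]
    rw [this, Complex.norm_conj]
  have h1 : ∫ t in (-π)..π, G (t - x) = ∫ t in (-π)..π, G t := by
    rw [intervalIntegral.integral_comp_sub_right G x]
    have := hper.intervalIntegral_add_eq (-π - x) (-π)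
    rw [show -π - x + 2 * π = π - x by ring, show -π + 2 * π = π by ring] at this
    exact this
  have h2 : ∫ t in (-π)..0, G t = ∫ t in (0 : ℝ)..π, G t := by
    have := intervalIntegral.integral_comp_neg (a := 0) (b := π) G
    rw [neg_zero] at this
    rw [← this]
    exact intervalIntegral.integral_congr fun t _ => heven t
  change ∫ t in (-π)..π, G (t - x) = _
  rw [h1, ← intervalIntegral.integral_add_adjacent_intervals (hGc.intervalIntegrable (-π) 0)
    (hGc.intervalIntegrable 0 π), h2]
  ring

theorem IsPsiDeriv.abs_sum_harmonicTerm_le {ψ : ℕ → ℝ} {β : ℝ} {f φ : ℝ → ℝ}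
    (h : IsPsiDeriv ψ β f φ) (hψ : ∀ k, 1 ≤ k → ψ k ≠ 0) {m : ℕ → ℝ} (hm : m 0 = 0) (R : ℕ)
    (x : ℝ) :
    |∑ k ∈ Finset.range R, m k * harmonicTerm f k x| ≤
      2 / π * ∫ t in (0 : ℝ)..π,
        ‖∑ k ∈ Finset.range R, ((m k * ψ k : ℝ) : ℂ) * Complex.exp (t * Complex.I) ^ k‖ := by
  have e : ∑ k ∈ Finset.range R, m k * harmonicTerm f k x = (1 / π) * ∫ t in (-π)..π,
      φ t * ∑ k ∈ Finset.range R, m k * ψ k * Real.cos (k * (t - x) + β * π / 2) := by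
    have e1 : ∀ t, φ t * ∑ k ∈ Finset.range R, m k * ψ k * Real.cos (k * (t - x) + β * π / 2) =
        ∑ k ∈ Finset.range R, m k * ψ k * (φ t * Real.cos (k * (t - x) + β * π / 2)) := fun t => by
      rw [Finset.mul_sum]
      exact Finset.sum_congr rfl fun k _ => by ring
    simp_rw [e1]
    have hint : ∀ k ∈ Finset.range R, IntervalIntegrable
        (fun t => m k * ψ k * (φ t * Real.cos (k * (t - x) + β * π / 2))) volume (-π) π :=
      fun k _ => (h.1.intervalIntegrable_mul (by fun_prop) _ _).const_mul _
    rw [intervalIntegral.integral_finsetSum hint, Finset.mul_sum]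
    refine Finset.sum_congr rfl fun k _ => ?_
    rw [intervalIntegral.integral_const_mul]
    rcases Nat.eq_zero_or_pos k with rfl | hk
    · simp [hm]
    · rw [h.harmonicTerm_eq_integral hk (hψ k hk)]
      ring
  rw [e, abs_mul, abs_of_pos (by positivity)]
  have hle := intervalIntegral.norm_integral_le_of_norm_le (a := -π) (b := π)
    (f := fun t => φ t *
      ∑ k ∈ Finset.range R, m k * ψ k * Real.cos (k * (t - x) + β * π / 2))
    (g := fun t => ‖∑ k ∈ Finset.range R,
      ((m k * ψ k : ℝ) : ℂ) * Complex.exp (((t - x : ℝ) : ℂ) * Complex.I) ^ k‖)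
    (μ := volume) (by linarith [pi_pos]) (by
      filter_upwards [h.1.2.2] with t ht _
      rw [norm_mul]
      refine (mul_le_of_le_one_left (norm_nonneg _) ht).trans ?_
      exact abs_sum_mul_cos_le (fun k => m k * ψ k) R (t - x) (β * π / 2))
    (Continuous.intervalIntegrable (by fun_prop) _ _)
  rw [integral_norm_sum_exp_symm, Real.norm_eq_abs] at hle
  calc _ ≤ 1 / π * (2 * ∫ t in (0 : ℝ)..π,
        ‖∑ k ∈ Finset.range R, ((m k * ψ k : ℝ) : ℂ) * Complex.exp (t * Complex.I) ^ k‖) := by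
        gcongr
    _ = _ := by ring

/-- Multipliers of the remainder `f - U f`, truncated linearly between `n` and `n + M`. -/
def remainderMul (ψ : ℕ → ℝ) (n p M k : ℕ) : ℝ :=
  if k < n then 1 - lambdaU ψ n p k else max (1 - ((k : ℝ) - n) / M) 0

theorem linearThenConvex_remainder {ψ : ℕ → ℝ} (hpos : ∀ k, 1 ≤ k → 0 < ψ k)
    (hanti : ∀ a b, 1 ≤ a → a ≤ b → ψ b ≤ ψ a)
    (hconv : ∀ k, 1 ≤ k → 0 ≤ ψ (k + 2) - 2 * ψ (k + 1) + ψ k)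
    {n p M : ℕ} (hp : 1 ≤ p) (hpn : p ≤ n) (hM : 1 ≤ M) :
    LinearThenConvex (ψ n) p M (fun i => remainderMul ψ n p M (n - p + i) * ψ (n - p + i))
      (fun j => ψ (n + j) * max (1 - (j : ℝ) / M) 0) := by
  have hp0 : (p : ℝ) ≠ 0 := by positivity
  have hM0 : (0 : ℝ) < M := by exact_mod_cast hM
  have hψn := hpos n (hp.trans hpn)
  have tail : ∀ j, remainderMul ψ n p M (n - p + (p + j)) * ψ (n - p + (p + j)) =
      ψ (n + j) * max (1 - (j : ℝ) / M) 0 := fun j => by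
    rw [show n - p + (p + j) = n + j by omega, remainderMul, if_neg (by omega)]
    push_cast
    rw [add_sub_cancel_left, mul_comm]
  have banti : Antitone fun j : ℕ => max (1 - (j : ℝ) / M) 0 := fun i j hij => by
    dsimp only
    gcongr
  have bnn : ∀ j : ℕ, 0 ≤ max (1 - (j : ℝ) / M) 0 := fun j => le_max_right _ _
  have bconv : ∀ j : ℕ, 2 * max (1 - ((j + 1 : ℕ) : ℝ) / M) 0 ≤
      max (1 - ((j + 2 : ℕ) : ℝ) / M) 0 + max (1 - (j : ℝ) / M) 0 := fun j => by
    rcases le_total (1 - ((j + 1 : ℕ) : ℝ) / M) 0 with h | h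
    · rw [max_eq_right h]
      linarith [bnn (j + 2), bnn j]
    · rw [max_eq_left h]
      have h1 := le_max_left (1 - ((j + 2 : ℕ) : ℝ) / M) 0
      have h2 := le_max_left (1 - (j : ℝ) / M) 0
      push_cast at *
      have : 2 * (1 - ((j : ℝ) + 1) / M) = (1 - ((j : ℝ) + 2) / M) + (1 - (j : ℝ) / M) := by
        field_simp
        ring
      linarith
  refine ⟨hp, fun i hi => ?_, tail, fun j => ?_, fun i j hij => ?_, fun j => ?_, fun j hj => ?_⟩
  · rcases hi.eq_or_lt with rfl | hlt
    · have := tail 0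
      simp only [add_zero] at this
      rw [this, mul_div_assoc, div_self hp0]
      simp
    · rw [remainderMul, if_pos (by omega), lambdaU]
      have hcast : ((n - p + i : ℕ) : ℝ) = n - p + i := by
        rw [Nat.cast_add, Nat.cast_sub hpn]
      split_ifs with h
      · obtain rfl : i = 0 := by omega
        simp
      · have := (hpos (n - p + i) (by omega)).ne'
        rw [hcast]
        field_simp
        ring
  · exact mul_nonneg (hpos _ (by omega)).le (bnn j)
  · exact mul_le_mul (hanti _ _ (by omega) (by omega)) (banti hij) (bnn j) (hpos _ (by omega)).le
  · have c1 := hconv (n + j) (by omega)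
    have c2 := bconv j
    have x0 : 0 ≤ ψ (n + j) - ψ (n + j + 2) := sub_nonneg.2 (hanti _ _ (by omega) (by omega))
    have y0 := sub_nonneg.2 (banti (show j ≤ j + 2 by omega))
    have x1 := (hpos (n + j + 1) (by omega)).le
    have y1 := bnn (j + 1)
    dsimp only at y0 ⊢
    rw [← add_assoc, ← add_assoc]
    generalize max (1 - ((j + 2 : ℕ) : ℝ) / M) 0 = b2 at *
    generalize max (1 - ((j + 1 : ℕ) : ℝ) / M) 0 = b1 at *
    generalize max (1 - (j : ℝ) / M) 0 = b0 at *
    generalize ψ (n + j + 2) = s2 at *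
    generalize ψ (n + j + 1) = s1 at *
    generalize ψ (n + j) = s0 at *
    have e1 := mul_nonneg x0 y0
    have e2 : (2 * s1) * (2 * b1) ≤ (s2 + s0) * (b2 + b0) :=
      mul_le_mul (by linarith) c2 (by linarith) (by linarith)
    nlinarith
  · have : (1 : ℝ) ≤ (j : ℝ) / M := by
      rw [le_div_iff₀ hM0, one_mul]
      exact_mod_cast hj
    rw [max_eq_right (by linarith), mul_zero]

theorem tendsto_remainderMul (ψ : ℕ → ℝ) (n p k : ℕ) :
    Tendsto (fun N => remainderMul ψ n p (p + N) k) atTop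
      (nhds (if k < n then 1 - lambdaU ψ n p k else 1)) := by
  unfold remainderMul
  split_ifs with h
  · exact tendsto_const_nhds
  · have h1 : Tendsto (fun N : ℕ => ((p + N : ℕ) : ℝ)) atTop atTop :=
      tendsto_natCast_atTop_atTop.comp (tendsto_atTop_mono (fun N => Nat.le_add_left N p) tendsto_id)
    have h2 := ((h1.const_div_atTop ((k : ℝ) - n)).const_sub 1).max
      (tendsto_const_nhds (x := (0 : ℝ)))
    simpa using h2

theorem periodic2pi_Usum (ψ : ℕ → ℝ) (n p : ℕ) (f : ℝ → ℝ) : Periodic2pi (Usum ψ n p f) :=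
  fun x => Finset.sum_congr rfl fun k _ => by rw [periodic2pi_harmonicTerm f k x]

/-- The remainder of `U f` is bounded by `ψ n` times a constant controlled by the initial drop of
`ψ` at `n` and by a logarithmically weighted tail sum. -/
theorem ClassC.abs_sub_Usum_le {ψ : ℕ → ℝ} (hpos : ∀ k, 1 ≤ k → 0 < ψ k)
    (hanti : ∀ a b, 1 ≤ a → a ≤ b → ψ b ≤ ψ a)
    (hconv : ∀ k, 1 ≤ k → 0 ≤ ψ (k + 2) - 2 * ψ (k + 1) + ψ k)
    {n p : ℕ} (hp : 1 ≤ p) (hpn : p ≤ n) {C₁ C₂ : ℝ}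
    (h₁ : p * (ψ n - ψ (n + 1)) ≤ C₁ * ψ n)
    (h₂ : ∀ N, ∑ j ∈ Finset.range N, ψ (n + j) / (p + j) ≤ C₂ * ψ n)
    {β : ℝ} {f : ℝ → ℝ} (hf : ClassC ψ β f) (x : ℝ) :
    |f x - Usum ψ n p f x| ≤
      2 / π * (1 + 4 * (1 + π) * C₂ + π ^ 2 / 2 * (2 + C₁)) * ψ n := by
  obtain ⟨hfc, hfp, φ, hφ⟩ := hf
  have hUc : Continuous (Usum ψ n p f) := continuous_sum_harmonicTerm f (lambdaU ψ n p) n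
  have hψn := hpos n (hp.trans hpn)
  have hp0 : (0 : ℝ) < p := by exact_mod_cast hp
  refine abs_le_of_fourier_tendsto (u := fun x => f x - Usum ψ n p f x) (hfc.sub hUc)
    (fun x => by simp only [hfp x, periodic2pi_Usum ψ n p f x])
    (v := fun N x => ∑ k ∈ Finset.range (n + (p + N)),
      remainderMul ψ n p (p + N) k * harmonicTerm f k x)
    (fun N => continuous_sum_harmonicTerm f _ _) (fun N y => ?_) (fun k => ?_) (fun k => ?_) x
  · set M := p + N with hMdef
    have hpM : (p : ℝ) ≤ M := by exact_mod_cast (by omega : p ≤ M)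
    have hM0 : (0 : ℝ) < M := hp0.trans_le hpM
    have hL := linearThenConvex_remainder hpos hanti hconv hp hpn (show 1 ≤ M by omega)
    have hzero : ∀ k < n - p, remainderMul ψ n p M k = 0 := fun k hk => by
      rw [remainderMul, if_pos (by omega), lambdaU, if_pos (by omega), sub_self]
    have hm0 : remainderMul ψ n p M 0 = 0 := by
      rw [remainderMul, if_pos (by omega), lambdaU, if_pos (by omega), sub_self]
    refine (hφ.abs_sum_harmonicTerm_le (fun k hk => (hpos k hk).ne') hm0 _ y).trans ?_
    have hnorm : ∀ t : ℝ, ‖∑ k ∈ Finset.range (n + M),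
        ((remainderMul ψ n p M k * ψ k : ℝ) : ℂ) * Complex.exp (t * Complex.I) ^ k‖ =
        ‖∑ i ∈ Finset.range (p + M), ((remainderMul ψ n p M (n - p + i) * ψ (n - p + i) : ℝ) : ℂ) *
          Complex.exp (t * Complex.I) ^ i‖ := fun t => by
      have e1 : ∑ k ∈ Finset.range (n - p),
          ((remainderMul ψ n p M k * ψ k : ℝ) : ℂ) * Complex.exp (t * Complex.I) ^ k = 0 :=
        Finset.sum_eq_zero fun k hk => by rw [hzero k (Finset.mem_range.1 hk)]; simp
      rw [show n + M = n - p + (p + M) by omega, Finset.sum_range_add, e1, zero_add]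
      have e2 : ∀ i, ((remainderMul ψ n p M (n - p + i) * ψ (n - p + i) : ℝ) : ℂ) *
          Complex.exp (t * Complex.I) ^ (n - p + i) = Complex.exp (t * Complex.I) ^ (n - p) *
          (((remainderMul ψ n p M (n - p + i) * ψ (n - p + i) : ℝ) : ℂ) *
            Complex.exp (t * Complex.I) ^ i) := fun i => by ring
      rw [Finset.sum_congr rfl fun i _ => e2 i, ← Finset.mul_sum, norm_mul, norm_pow,
        Complex.norm_exp_ofReal_mul_I, one_pow, one_mul]
    simp_rw [hnorm]
    rw [mul_assoc]
    refine mul_le_mul_of_nonneg_left (hL.integral_norm_sum_le.trans ?_) (by positivity)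
    have b1 : ∑ j ∈ Finset.range M, ψ (n + j) * max (1 - (j : ℝ) / M) 0 / (p + j) ≤ C₂ * ψ n := by
      refine le_trans (Finset.sum_le_sum fun j _ => ?_) (h₂ M)
      have hj := (hpos (n + j) (by omega)).le
      have : max (1 - (j : ℝ) / M) 0 ≤ 1 :=
        max_le (by have : (0 : ℝ) ≤ (j : ℝ) / M := by positivity
                   linarith) zero_le_one
      gcongr
      exact mul_le_of_le_one_right hj this
    have b2 : p * (ψ (n + 0) * max (1 - ((0 : ℕ) : ℝ) / M) 0 -
        ψ (n + 1) * max (1 - ((1 : ℕ) : ℝ) / M) 0) ≤ (1 + C₁) * ψ n := by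
      have e0 : max (1 - ((0 : ℕ) : ℝ) / M) 0 = 1 := by simp
      have e1 := le_max_left (1 - ((1 : ℕ) : ℝ) / M) 0
      have e2 : ψ (n + 1) ≤ ψ n := hanti _ _ (by omega) (by omega)
      have e3 := (hpos (n + 1) (by omega)).le
      have e4 := mul_le_mul_of_nonneg_left e1 e3
      have e5 : p * (ψ (n + 1) * (1 / M)) ≤ ψ n := by
        have : p * (ψ (n + 1) * (1 / M)) = ψ (n + 1) * (p / M) := by ring
        rw [this]
        exact (mul_le_of_le_one_right e3 ((div_le_one hM0).2 hpM)).trans e2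
      have e6 : p * (ψ n - ψ (n + 1) * max (1 - ((1 : ℕ) : ℝ) / M) 0) ≤
          p * (ψ n - ψ (n + 1) * (1 - ((1 : ℕ) : ℝ) / M)) := by gcongr
      rw [e0, add_zero, mul_one]
      refine e6.trans ?_
      rw [Nat.cast_one]
      linarith
    have b3 : 4 * (1 + π) * ∑ j ∈ Finset.range M,
        ψ (n + j) * max (1 - (j : ℝ) / M) 0 / (p + j) ≤ 4 * (1 + π) * (C₂ * ψ n) := by gcongr
    have b4 : π ^ 2 / 2 * (ψ n + p * (ψ (n + 0) * max (1 - ((0 : ℕ) : ℝ) / M) 0 -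
        ψ (n + 1) * max (1 - ((1 : ℕ) : ℝ) / M) 0)) ≤ π ^ 2 / 2 * (ψ n + (1 + C₁) * ψ n) := by
      gcongr
    linarith
  · simp_rw [fun N => fourierA_sum_harmonicTerm f (remainderMul ψ n p (p + N)) (n + (p + N)) k]
    have hU : fourierA (Usum ψ n p f) k = if k < n then lambdaU ψ n p k * fourierA f k else 0 :=
      fourierA_sum_harmonicTerm f (lambdaU ψ n p) n k
    rw [fourierA_sub hfc hUc, hU]
    have hlim := (tendsto_remainderMul ψ n p k).mul_const (fourierA f k)
    have hval : (if k < n then 1 - lambdaU ψ n p k else 1) * fourierA f k =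
        fourierA f k - if k < n then lambdaU ψ n p k * fourierA f k else 0 := by
      split_ifs <;> ring
    rw [hval] at hlim
    refine hlim.congr' ?_
    filter_upwards [eventually_ge_atTop k] with N hN
    rw [if_pos (by omega)]
  · simp_rw [fun N => fourierB_sum_harmonicTerm f (remainderMul ψ n p (p + N)) (n + (p + N)) k]
    have hU : fourierB (Usum ψ n p f) k = if k < n then lambdaU ψ n p k * fourierB f k else 0 :=
      fourierB_sum_harmonicTerm f (lambdaU ψ n p) n k
    rw [fourierB_sub hfc hUc, hU]
    have hlim := (tendsto_remainderMul ψ n p k).mul_const (fourierB f k)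
    have hval : (if k < n then 1 - lambdaU ψ n p k else 1) * fourierB f k =
        fourierB f k - if k < n then lambdaU ψ n p k * fourierB f k else 0 := by
      split_ifs <;> ring
    rw [hval] at hlim
    refine hlim.congr' ?_
    filter_upwards [eventually_ge_atTop k] with N hN
    rw [if_pos (by omega)]

theorem IsTrigPoly.continuous {m : ℕ} {g : ℝ → ℝ} (hg : IsTrigPoly m g) : Continuous g := by
  obtain ⟨c, d, h⟩ := hg
  rw [funext h]
  fun_prop

theorem IsTrigPoly.exists_bound {m : ℕ} {g : ℝ → ℝ} (hg : IsTrigPoly m g) :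
    ∃ D, ∀ x, |g x| ≤ D := by
  obtain ⟨c, d, h⟩ := hg
  refine ⟨∑ k ∈ Finset.range (m + 1), (|c k| + |d k|), fun x => ?_⟩
  rw [h]
  refine (Finset.abs_sum_le_sum_abs _ _).trans (Finset.sum_le_sum fun k _ => ?_)
  refine (abs_add_le _ _).trans ?_
  rw [abs_mul, abs_mul]
  exact add_le_add (mul_le_of_le_one_right (abs_nonneg _) (abs_cos_le_one _))
    (mul_le_of_le_one_right (abs_nonneg _) (abs_sin_le_one _))

theorem IsTrigPoly.fourierA_eq_zero {m n : ℕ} {g : ℝ → ℝ} (hg : IsTrigPoly m g) (hmn : m < n) :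
    fourierA g n = 0 := by
  obtain ⟨c, d, h⟩ := hg
  have hint : ∀ k ∈ Finset.range (m + 1), IntervalIntegrable
      (fun t => (c k * Real.cos (k * t) + d k * Real.sin (k * t)) * Real.cos (n * t))
      volume (-π) π := fun k _ => Continuous.intervalIntegrable (by fun_prop) _ _
  rw [funext h]
  unfold fourierA
  simp_rw [Finset.sum_mul]
  rw [intervalIntegral.integral_finsetSum hint, Finset.mul_sum]
  refine Finset.sum_eq_zero fun k hk => ?_
  have := fourierA_trig (c k) (d k) k n
  rwa [if_neg (by rw [Finset.mem_range] at hk; omega)] at this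

theorem IsTrigPoly.fourierB_eq_zero {m n : ℕ} {g : ℝ → ℝ} (hg : IsTrigPoly m g) (hmn : m < n) :
    fourierB g n = 0 := by
  obtain ⟨c, d, h⟩ := hg
  have hint : ∀ k ∈ Finset.range (m + 1), IntervalIntegrable
      (fun t => (c k * Real.cos (k * t) + d k * Real.sin (k * t)) * Real.sin (n * t))
      volume (-π) π := fun k _ => Continuous.intervalIntegrable (by fun_prop) _ _
  rw [funext h]
  unfold fourierB
  simp_rw [Finset.sum_mul]
  rw [intervalIntegral.integral_finsetSum hint, Finset.mul_sum]
  refine Finset.sum_eq_zero fun k hk => ?_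
  have := fourierB_trig (c k) (d k) k n
  rwa [if_neg (by rw [Finset.mem_range] at hk; omega)] at this

theorem fourierA_mul_cos_add_fourierB_mul_sin_le {u : ℝ → ℝ} (hu : Continuous u) {C : ℝ}
    (hC : ∀ x, |u x| ≤ C) (n : ℕ) (θ : ℝ) :
    fourierA u n * Real.cos θ + fourierB u n * Real.sin θ ≤ 2 * C := by
  have e : fourierA u n * Real.cos θ + fourierB u n * Real.sin θ =
      (1 / π) * ∫ t in (-π)..π, u t * Real.cos (n * t - θ) := by
    have e1 : ∀ t : ℝ, u t * Real.cos (n * t - θ) =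
        u t * Real.cos (n * t) * Real.cos θ + u t * Real.sin (n * t) * Real.sin θ := fun t => by
      rw [Real.cos_sub]
      ring
    simp_rw [e1]
    rw [intervalIntegral.integral_add (Continuous.intervalIntegrable (by fun_prop) _ _)
      (Continuous.intervalIntegrable (by fun_prop) _ _), intervalIntegral.integral_mul_const,
      intervalIntegral.integral_mul_const]
    unfold fourierA fourierB
    ring
  have h := intervalIntegral.norm_integral_le_of_norm_le_const (a := -π) (b := π)
    (f := fun t => u t * Real.cos (n * t - θ)) (C := C) fun t _ => by
      rw [norm_mul]
      exact (mul_le_of_le_one_right (norm_nonneg _) (abs_cos_le_one _)).trans (hC t)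
  rw [e]
  rw [Real.norm_eq_abs, abs_of_pos (show 0 < π - -π by linarith [pi_pos])] at h
  calc _ ≤ 1 / π * (C * (π - -π)) := by
        gcongr
        exact (le_abs_self _).trans h
    _ = 2 * C := by
        field_simp
        ring

/-- A single harmonic of order `n` stays at distance at least half its amplitude from trigonometric
polynomials of lower degree. -/
theorem IsTrigPoly.half_amplitude_le {m n : ℕ} {g : ℝ → ℝ} (hg : IsTrigPoly m g) (hmn : m < n)
    (A θ : ℝ) :
    1 / 2 * A ≤ ⨆ x : ℝ,
      |(A * Real.cos θ * Real.cos (n * x) + A * Real.sin θ * Real.sin (n * x)) - g x| := by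
  set f : ℝ → ℝ := fun x => A * Real.cos θ * Real.cos (n * x) + A * Real.sin θ * Real.sin (n * x)
    with hf
  have hfc : Continuous f := by rw [hf]; fun_prop
  obtain ⟨D, hD⟩ := hg.exists_bound
  have hbdd : BddAbove (range fun x => |f x - g x|) := by
    refine ⟨|A * Real.cos θ| + |A * Real.sin θ| + D, ?_⟩
    rintro _ ⟨x, rfl⟩
    refine (abs_sub _ _).trans (add_le_add ((abs_add_le _ _).trans ?_) (hD x))
    rw [abs_mul (A * Real.cos θ), abs_mul (A * Real.sin θ)]
    exact add_le_add (mul_le_of_le_one_right (abs_nonneg _) (abs_cos_le_one _))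
      (mul_le_of_le_one_right (abs_nonneg _) (abs_sin_le_one _))
  have h := fourierA_mul_cos_add_fourierB_mul_sin_le
    (u := fun x => f x - g x) (hfc.sub hg.continuous) (fun x => le_ciSup hbdd x) n θ
  have hn : n ≠ 0 := by omega
  have hA : fourierA f n = A * Real.cos θ := by
    rw [hf, fourierA_trig, if_pos rfl, if_neg hn]
  have hB : fourierB f n = A * Real.sin θ := by
    rw [hf, fourierB_trig, if_pos rfl, if_neg hn]
  rw [fourierA_sub hfc hg.continuous, fourierB_sub hfc hg.continuous, hg.fourierA_eq_zero hmn,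
    hg.fourierB_eq_zero hmn, hA, hB] at h
  have hs := Real.sin_sq_add_cos_sq θ
  have e : A = (A * Real.cos θ - 0) * Real.cos θ + (A * Real.sin θ - 0) * Real.sin θ := by
    linear_combination -A * hs
  linarith

theorem isTrigPoly_Usum (ψ : ℕ → ℝ) {n : ℕ} (hn : 1 ≤ n) (p : ℕ) (f : ℝ → ℝ) :
    IsTrigPoly (n - 1) (Usum ψ n p f) := by
  refine ⟨fun k => lambdaU ψ n p k * if k = 0 then fourierA f 0 / 2 else fourierA f k,
    fun k => lambdaU ψ n p k * fourierB f k, fun x => ?_⟩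
  rw [Nat.sub_add_cancel hn]
  refine Finset.sum_congr rfl fun k _ => ?_
  rw [harmonicTerm_eq]
  ring

theorem classC_single_harmonic (ψ : ℕ → ℝ) (β : ℝ) {n : ℕ} (hn : 1 ≤ n) (hψ : ψ n ≠ 0) :
    ClassC ψ β fun x => ψ n * Real.cos (β * π / 2) * Real.cos (n * x) +
      ψ n * Real.sin (β * π / 2) * Real.sin (n * x) := by
  have hper : ∀ x : ℝ, (n : ℝ) * (x + 2 * π) = n * x + n * (2 * π) := fun x => by ring
  have hs := Real.sin_sq_add_cos_sq (β * π / 2)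
  refine ⟨by fun_prop, fun x => ?_, fun x => 1 * Real.cos (n * x) + 0 * Real.sin (n * x),
    ⟨by fun_prop, fun x => ?_, ?_⟩, ?_, fun k hk => ⟨?_, ?_⟩⟩
  · simp only [hper, Real.cos_add_nat_mul_two_pi, Real.sin_add_nat_mul_two_pi]
  · simp only [hper, Real.cos_add_nat_mul_two_pi, Real.sin_add_nat_mul_two_pi]
  · refine Eventually.of_forall fun t => ?_
    dsimp only
    rw [one_mul, zero_mul, add_zero]
    exact abs_cos_le_one _
  · rw [fourierA_trig, if_neg (by omega)]
  · rw [fourierA_trig, fourierA_trig, fourierB_trig]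
    by_cases h : n = k
    · subst h
      rw [if_pos rfl, if_pos rfl, if_pos rfl, if_neg (by omega), if_neg (by omega),
        if_neg (by omega)]
      field_simp
      linear_combination -hs
    · simp [h]
  · rw [fourierB_trig, fourierA_trig, fourierB_trig]
    by_cases h : n = k
    · subst h
      rw [if_pos rfl, if_pos rfl, if_pos rfl, if_neg (by omega), if_neg (by omega),
        if_neg (by omega)]
      ring
    · simp [h]

/-- A uniform bound for `f - U f` on the class pins down both extremal quantities. -/
theorem classSup_and_bestApproxClass_bounds {ψ : ℕ → ℝ} {β : ℝ} {n p : ℕ} (hn : 1 ≤ n)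
    (hψ : 0 < ψ n) {C : ℝ}
    (hC : ∀ f, ClassC ψ β f → ∀ x, |f x - Usum ψ n p f x| ≤ C) :
    (1 / 2 * ψ n ≤ classSup ψ β (Usum ψ n p) ∧ classSup ψ β (Usum ψ n p) ≤ C) ∧
      (1 / 2 * ψ n ≤ bestApproxClass ψ β n ∧ bestApproxClass ψ β n ≤ C) := by
  have hmem := classC_single_harmonic ψ β hn hψ.ne'
  have hlow {g : ℝ → ℝ} (hg : IsTrigPoly (n - 1) g) :=
    hg.half_amplitude_le (show n - 1 < n by omega) (ψ n) (β * π / 2)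
  have hsup : ∀ f, ClassC ψ β f → ⨆ x, |f x - Usum ψ n p f x| ≤ C := fun f hf => ciSup_le (hC f hf)
  have hinf : ∀ f, ClassC ψ β f →
      sInf {r | ∃ g, IsTrigPoly (n - 1) g ∧ r = ⨆ x : ℝ, |f x - g x|} ≤ C := fun f hf => by
    refine csInf_le_of_le ⟨0, ?_⟩ ⟨_, isTrigPoly_Usum ψ hn p f, rfl⟩ (hsup f hf)
    rintro _ ⟨g, _, rfl⟩
    exact Real.iSup_nonneg fun x => abs_nonneg _
  have ub1 : C ∈ upperBounds {e | ∃ f, ClassC ψ β f ∧ e = ⨆ x, |f x - Usum ψ n p f x|} := by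
    rintro _ ⟨f, hf, rfl⟩
    exact hsup f hf
  have ub2 : C ∈ upperBounds {e | ∃ f, ClassC ψ β f ∧
      e = sInf {r | ∃ g, IsTrigPoly (n - 1) g ∧ r = ⨆ x : ℝ, |f x - g x|}} := by
    rintro _ ⟨f, hf, rfl⟩
    exact hinf f hf
  refine ⟨⟨(hlow (isTrigPoly_Usum ψ hn p _)).trans (le_csSup ⟨C, ub1⟩ ⟨_, hmem, rfl⟩),
    csSup_le ⟨_, _, hmem, rfl⟩ ub1⟩, ?_, csSup_le ⟨_, _, hmem, rfl⟩ ub2⟩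
  refine le_csSup_of_le ⟨C, ub2⟩ ⟨_, hmem, rfl⟩ ?_
  refine le_csInf ⟨_, _, isTrigPoly_Usum ψ hn p 0, rfl⟩ ?_
  rintro _ ⟨g, hg, rfl⟩
  exact hlow hg

theorem MClass.nat_properties {ψ : ℝ → ℝ} (h : MClass ψ) :
    (∀ k : ℕ, 1 ≤ k → 0 < ψ k) ∧ (∀ a b : ℕ, 1 ≤ a → a ≤ b → ψ b ≤ ψ a) ∧
      ∀ k : ℕ, 1 ≤ k →
        0 ≤ ψ ((k + 2 : ℕ) : ℝ) - 2 * ψ ((k + 1 : ℕ) : ℝ) + ψ k := by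
  have hmem : ∀ {k : ℕ}, 1 ≤ k → (k : ℝ) ∈ Ici (1 : ℝ) := fun hk => by
    rw [mem_Ici]
    exact_mod_cast hk
  refine ⟨fun k hk => h.1 k (hmem hk), fun a b ha hab =>
    h.strictAntiOn.antitoneOn (hmem ha) (hmem (ha.trans hab)) (by exact_mod_cast hab),
    fun k hk => ?_⟩
  have := h.2.1.2 (hmem hk) (hmem (show 1 ≤ k + 2 by omega)) (show (0 : ℝ) ≤ 1 / 2 by norm_num)
    (show (0 : ℝ) ≤ 1 / 2 by norm_num) (by norm_num)
  have e : (1 / 2 : ℝ) • (k : ℝ) + (1 / 2 : ℝ) • ((k + 2 : ℕ) : ℝ) = ((k + 1 : ℕ) : ℝ) := by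
    rw [smul_eq_mul, smul_eq_mul]
    push_cast
    ring
  rw [e, smul_eq_mul, smul_eq_mul] at this
  linarith

/-- if `ψ ∈ F` and `p(n) ≤ n` with `T(n) ≍ p(n)`, then
`E(C^ψ_{β,∞}; U^ψ_{n,p(n)}) ≍ E_n(C^ψ_{β,∞}) ≍ ψ(n)`. -/
theorem statement1 (ψ : ℝ → ℝ) (hψ : FClass ψ) (β : ℝ) (p : ℕ → ℕ)
    (hp : ∀ n : ℕ, 1 ≤ n → 1 ≤ p n ∧ p n ≤ n)
    (hT : ∃ c₁ c₂ : ℝ, 0 < c₁ ∧ c₁ ≤ c₂ ∧ ∀ n : ℕ, 1 ≤ n →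
      c₁ * p n ≤ eta ψ n - n ∧ eta ψ n - n ≤ c₂ * p n) :
    ∃ K₁ K₂ : ℝ, 0 < K₁ ∧ 0 < K₂ ∧ ∀ n : ℕ, 1 ≤ n →
      (K₁ * ψ n ≤ classSup (fun k : ℕ => ψ k) β (Usum (fun k : ℕ => ψ k) n (p n)) ∧
        classSup (fun k : ℕ => ψ k) β (Usum (fun k : ℕ => ψ k) n (p n)) ≤ K₂ * ψ n) ∧
      (K₁ * ψ n ≤ bestApproxClass (fun k : ℕ => ψ k) β n ∧
        bestApproxClass (fun k : ℕ => ψ k) β n ≤ K₂ * ψ n) := by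
  obtain ⟨c₁, c₂, hc₁, -, hT⟩ := hT
  obtain ⟨hM, K, hK⟩ := id hψ
  obtain ⟨hpos, hanti, hconv⟩ := hM.nat_properties
  obtain ⟨L, hL, hdec⟩ := hψ.geometric_decay hp fun n hn => (hT n hn).2
  set C₁ : ℝ := 1 + |K| / c₁ with hC₁
  have hC₁pos : 0 < C₁ := by positivity
  have hdrop : ∀ n : ℕ, 1 ≤ n → p n * (ψ n - ψ ((n + 1 : ℕ) : ℝ)) ≤ C₁ * ψ n := by
    intro n hn
    have h0 := hpos n hn
    have h1 := (hpos (n + 1) (by omega)).le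
    rcases hn.eq_or_lt with rfl | hlt
    · have : p 1 = 1 := le_antisymm (hp 1 le_rfl).2 (hp 1 le_rfl).1
      rw [this]
      have : 0 ≤ |K| / c₁ * ψ ((1 : ℕ) : ℝ) := by positivity
      rw [hC₁]
      push_cast at *
      linarith
    · have h2 := hM.sub_succ_mul_le hK (t := n) (by exact_mod_cast hlt)
      have h3 : 0 ≤ ψ n - ψ ((n + 1 : ℕ) : ℝ) := sub_nonneg.2 (hanti n (n + 1) hn (by omega))
      push_cast at h3 ⊢
      have h4 := mul_le_mul_of_nonneg_left (hT n hn).1 h3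
      have h5 : K * ψ n ≤ |K| * ψ n := by gcongr; exact le_abs_self K
      have h6 : p n * (ψ n - ψ (n + 1)) ≤ |K| / c₁ * ψ n := by
        rw [div_mul_eq_mul_div, le_div_iff₀ hc₁]
        linarith
      rw [hC₁]
      linarith
  refine ⟨1 / 2, 2 / π * (1 + 4 * (1 + π) * (1 + 4 * L) + π ^ 2 / 2 * (2 + C₁)), by norm_num,
    by positivity, fun n hn => ?_⟩
  refine classSup_and_bestApproxClass_bounds (ψ := fun k : ℕ => ψ k) hn (hpos n hn)
    fun f hf x => hf.abs_sub_Usum_le (ψ := fun k : ℕ => ψ k) hpos hanti hconv (hp n hn).1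
      (hp n hn).2 (hdrop n hn) (fun N => ?_) x
  exact sum_div_add_le (u := fun j => ψ ((n + j : ℕ) : ℝ)) (fun j => (hpos _ (by omega)).le)
    (fun i j hij => hanti _ _ (by omega) (by omega)) (hp n hn).1 hL (hdec n hn) N
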